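/- For every real δ > 0 there exists an integer n₀ such that for all integers n₁ ≥ n₂ ≥ n₃ > n₀ one has 8n₁ < R(C_{2n₁+1}, C_{2n₂+1}, C_{2n₃+1}) ≤ (8+δ)n₁. -/

import Mathlib

/-- `F` has a cycle of length `m`, all of whose edges get color `i` under `c`. -/
def HasMonoCycle {V : Type*} (F : SimpleGraph V) {k : ℕ} (c : F.edgeSet → Fin k)
    (i : Fin k) (m : ℕ) : Prop :=
  ∃ (v : V) (w : F.Walk v v), w.IsCycle ∧ w.length = m ∧
    ∀ e (h : e ∈ w.edges), c ⟨e, w.edges_subset_edgeSet h⟩ = i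

/-- `F → (C_{n 0}, …, C_{n (k-1)})`: every `k`-coloring of the edges of `F` yields,
for some color `i`, a cycle on `n i` vertices all of whose edges have color `i`. -/
def ArrowsCycles {V : Type*} (F : SimpleGraph V) {k : ℕ} (n : Fin k → ℕ) : Prop :=
  ∀ c : F.edgeSet → Fin k, ∃ i : Fin k, HasMonoCycle F c i (n i)

/-- The Ramsey number `R(C_{n 0}, …, C_{n (k-1)})`, the least `N` such that
`K_N → (C_{n 0}, …, C_{n (k-1)})`. -/
noncomputable def ramseyCycles {k : ℕ} (n : Fin k → ℕ) : ℕ :=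
  sInf {N : ℕ | ArrowsCycles (⊤ : SimpleGraph (Fin N)) n}

/-- A closed walk along which a Boolean function changes at every step has even length. -/
lemma SimpleGraph.Walk.even_length_of_alternating {V : Type*} {F : SimpleGraph V} (b : V → Bool)
    {u v : V} (w : F.Walk u v)
    (h : ∀ x y, s(x, y) ∈ w.edges → b x ≠ b y) : Even w.length ↔ b u = b v := by
  induction w with
  | nil => simp
  | @cons u u' v huv w ih =>
    have h1 := ih fun x y hxy => h x y (by simp [hxy])
    have h2 := h u u' (by simp)
    rw [SimpleGraph.Walk.length_cons, Nat.even_add_one, h1]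
    revert h2
    cases b u <;> cases b u' <;> cases b v <;> decide

/-- A walk along which a function is constant at every step stays in one fibre. -/
lemma SimpleGraph.Walk.eq_of_mem_support_of_constant {V α : Type*} {F : SimpleGraph V} (b : V → α)
    {u v : V} (w : F.Walk u v) (h : ∀ x y, s(x, y) ∈ w.edges → b x = b y) :
    ∀ z ∈ w.support, b z = b u := by
  induction w with
  | nil => simp
  | @cons u u' v huv w ih =>
    have h1 := ih fun x y hxy => h x y (by simp [hxy])
    have h2 := h u u' (by simp)
    intro z hz
    rw [SimpleGraph.Walk.support_cons, List.mem_cons] at hz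
    rcases hz with rfl | hz
    · rfl
    · rw [h1 z hz, h2]

open scoped Classical in
lemma not_arrowsCycles_of_le {n₁ n₂ n₃ N : ℕ} (h₁ : 0 < n₁) (hN : N ≤ 8 * n₁) :
    ¬ ArrowsCycles (⊤ : SimpleGraph (Fin N)) ![2 * n₁ + 1, 2 * n₂ + 1, 2 * n₃ + 1] := by
  intro hA
  let b : Fin N → ℕ := fun v => v.val / (2 * n₁)
  have hb : ∀ v, b v < 4 := fun v => by
    have := v.2
    exact Nat.div_lt_of_lt_mul (by omega)
  obtain ⟨i, v, w, hw, hlen, hcol⟩ := hA fun e =>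
    if ∀ x ∈ e.1, ∀ y ∈ e.1, b x = b y then 0
    else if ∀ x ∈ e.1, ∀ y ∈ e.1, b x % 2 = b y % 2 then 2 else 1
  have hedge : ∀ x y (h : s(x, y) ∈ w.edges), (if b x = b y then (0 : Fin 3)
      else if b x % 2 = b y % 2 then 2 else 1) = i := by
    intro x y h
    have := hcol _ h
    simp only [Sym2.mem_iff, forall_eq_or_imp, forall_eq, true_and, and_true] at this
    rw [← this]
    simp only [eq_comm (a := b y), eq_comm (a := b y % 2), and_self]
  fin_cases i
  · have hc := w.eq_of_mem_support_of_constant b fun x y h => by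
      have := hedge x y h
      by_contra hne
      rw [if_neg hne] at this
      split_ifs at this <;> simp at this
    have hsub : w.support.tail.toFinset.card ≤ 2 * n₁ := by
      have : (w.support.tail.toFinset.image Fin.val) ⊆
          Finset.Ico (b v * (2 * n₁)) (b v * (2 * n₁) + 2 * n₁) := by
        intro z hz
        simp only [Finset.mem_image, List.mem_toFinset] at hz
        obtain ⟨z, hz, rfl⟩ := hz
        rw [← hc z (List.mem_of_mem_tail hz), Finset.mem_Ico]
        refine ⟨Nat.div_mul_le_self _ _, ?_⟩
        have := Nat.lt_div_mul_add (a := z.val) (b := 2 * n₁) (by omega)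
        exact this
      have := Finset.card_le_card this
      rwa [Finset.card_image_of_injective _ Fin.val_injective, Nat.card_Ico,
        Nat.add_sub_cancel_left] at this
    rw [List.toFinset_card_of_nodup hw.support_nodup, List.length_tail,
      SimpleGraph.Walk.length_support, hlen] at hsub
    simp at hsub
  · have := (w.even_length_of_alternating (fun v => decide (b v % 2 = 0)) fun x y h => by
      have := hedge x y h
      split_ifs at this with h1 h2
      · simp at this
      · simp at this
      · intro h3
        rw [decide_eq_decide] at h3
        omega).2 rfl
    rw [hlen] at this
    simp at this
  · have := (w.even_length_of_alternating (fun v => decide (b v < 2)) fun x y h => by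
      have := hedge x y h
      split_ifs at this with h1 h2
      · simp at this
      · intro h3
        rw [decide_eq_decide] at h3
        have := hb x
        have := hb y
        omega
      · simp at this).2 rfl
    rw [hlen] at this
    simp at this

/-- Two vertices carry the same genuine label. -/
def SameLabel {V κ : Type*} (g : V → Option κ) (u v : V) : Prop :=
  g u ≠ none ∧ g u = g v

open scoped Classical in
/-- A sum over a set covered by two pieces and a small remainder. -/
lemma sum_le_of_subset_two_pieces {V : Type*} {X A B R : Finset V} {F : V → ℝ} {M : ℝ}
    (hF0 : ∀ v ∈ X, 0 ≤ F v) (hF1 : ∀ v ∈ X, F v ≤ 1)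
    (hA : A ⊆ X) (hB : B ⊆ X) (hX : X ⊆ A ∪ B ∪ R)
    (hAM : ∑ v ∈ A, F v ≤ M / 2) (hBM : ∑ v ∈ B, F v ≤ M / 2) :
    ∑ v ∈ X, F v ≤ M + R.card := by
  have h1 : ∑ v ∈ X, F v ≤ ∑ v ∈ A, F v + ∑ v ∈ B, F v + ∑ v ∈ R ∩ X, F v := by
    have hX' : X = (A ∪ B) ∪ (R ∩ X) := by
      ext x
      have := @hX x
      have := @hA x
      have := @hB x
      simp only [Finset.mem_union, Finset.mem_inter] at *
      tauto
    have h2 := Finset.sum_union_inter (s₁ := A ∪ B) (s₂ := R ∩ X) (f := F)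
    have h3 := Finset.sum_union_inter (s₁ := A) (s₂ := B) (f := F)
    rw [← hX'] at h2
    have h4 : 0 ≤ ∑ v ∈ (A ∪ B) ∩ (R ∩ X), F v :=
      Finset.sum_nonneg fun v hv => hF0 v (by simp only [Finset.mem_inter] at hv; exact hv.2.2)
    have h5 : 0 ≤ ∑ v ∈ A ∩ B, F v :=
      Finset.sum_nonneg fun v hv => hF0 v (by simp only [Finset.mem_inter] at hv; exact hA hv.1)
    linarith
  have h2 : ∑ v ∈ R ∩ X, F v ≤ R.card := by
    calc ∑ v ∈ R ∩ X, F v ≤ ∑ v ∈ R ∩ X, (1 : ℝ) :=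
          Finset.sum_le_sum fun v hv => hF1 v (Finset.mem_inter.1 hv).2
      _ = ((R ∩ X).card : ℝ) := by simp
      _ ≤ R.card := by exact_mod_cast Finset.card_le_card Finset.inter_subset_left
  linarith

open scoped Classical in
lemma exists_adj_of_card_gt {V : Type*} {X Y : Finset V} {r : V → V → Prop} {D : ℕ} {v : V}
    (hv : (X.filter fun u => ¬ r v u).card ≤ D) (hY : Y ⊆ X) (hD : D < Y.card) :
    ∃ y ∈ Y, r v y := by
  by_contra! h
  have : Y ⊆ X.filter fun u => ¬ r v u := fun y hy => Finset.mem_filter.2 ⟨hY hy, h y hy⟩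
  have := Finset.card_le_card this
  omega

open scoped Classical in
lemma sum_le_of_sameLabel_first {V κ₁ κ₂ κ₃ : Type*} {X : Finset V}
    {g₁ : V → Option κ₁} {g₂ : V → Option κ₂} {g₃ : V → Option κ₃} {F : V → ℝ} {M : ℝ} {D : ℕ}
    (hF0 : ∀ v ∈ X, 0 ≤ F v) (hF1 : ∀ v ∈ X, F v ≤ 1)
    (h₁ : ∀ a, a ≠ none → ∑ v ∈ X with g₁ v = a, F v ≤ M / 2)
    (h₂ : ∀ a, a ≠ none → ∑ v ∈ X with g₂ v = a, F v ≤ M / 2) (hM : 0 ≤ M)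
    (hmiss : ∀ v ∈ X, (X.filter fun u =>
      ¬ (SameLabel g₁ v u ∨ SameLabel g₂ v u ∨ SameLabel g₃ v u)).card ≤ D)
    {u u' : V} (hu : u ∈ X) (hu' : u' ∈ X) (h3 : g₃ u ≠ g₃ u') (h1 : SameLabel g₁ u u') :
    ∑ v ∈ X, F v ≤ M + 4 * D := by
  set r : V → V → Prop := fun v u => SameLabel g₁ v u ∨ SameLabel g₂ v u ∨ SameLabel g₃ v u
  set N : V → Finset V := fun v => X.filter fun u => ¬ r v u with hN
  have key1 : ∀ b, ∑ v ∈ X with (g₂ v = b ∧ b ≠ none), F v ≤ M / 2 := by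
    intro b
    by_cases hb : b = none
    · simp only [hb, ne_eq, not_true_eq_false, and_false, Finset.filter_false, Finset.sum_empty]
      linarith
    · simpa [hb] using h₂ b hb
  have hcard : ∀ {R : Finset V}, R.card ≤ 4 * D → M + (R.card : ℝ) ≤ M + 4 * D := by
    intro R hR
    have : (R.card : ℝ) ≤ 4 * D := by exact_mod_cast hR
    linarith
  set K := X.filter fun v => g₁ v = g₁ u with hK
  have hKX : K ⊆ X := Finset.filter_subset _ _
  have hKM : ∑ v ∈ K, F v ≤ M / 2 := h₁ _ h1.1
  set R₁ := X.filter fun x => g₁ x ≠ g₁ u ∧ SameLabel g₂ u x ∧ SameLabel g₃ u' x with hR₁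
  set R₂ := X.filter fun x => g₁ x ≠ g₁ u ∧ SameLabel g₂ u' x ∧ SameLabel g₃ u x with hR₂
  have hNu := hmiss u hu
  have hNu' := hmiss u' hu'
  by_cases c1 : R₁.card ≤ D
  · refine (sum_le_of_subset_two_pieces (R := R₁ ∪ (N u ∪ N u')) hF0 hF1 hKX
      (Finset.filter_subset _ _)
      ?_ hKM (key1 (g₂ u'))).trans (hcard ?_)
    · intro x hx
      simp only [hK, hR₁, hN, r, SameLabel, Finset.mem_union, Finset.mem_filter] at *
      grind
    · refine (Finset.card_union_le _ _).trans ?_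
      have := Finset.card_union_le (N u) (N u')
      simp only [hN, r] at *
      omega
  by_cases c2 : R₂.card ≤ D
  · refine (sum_le_of_subset_two_pieces (R := R₂ ∪ (N u ∪ N u')) hF0 hF1 hKX
      (Finset.filter_subset _ _)
      ?_ hKM (key1 (g₂ u))).trans (hcard ?_)
    · intro x hx
      simp only [hK, hR₂, hN, r, SameLabel, Finset.mem_union, Finset.mem_filter] at *
      grind
    · refine (Finset.card_union_le _ _).trans ?_
      have := Finset.card_union_le (N u) (N u')
      simp only [hN, r] at *
      omega
  by_cases c3 : g₂ u = g₂ u'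
  · refine (sum_le_of_subset_two_pieces (R := N u ∪ N u') hF0 hF1 hKX
      (Finset.filter_subset _ _)
      ?_ hKM (key1 (g₂ u))).trans (hcard ?_)
    · intro x hx
      simp only [hK, hN, r, SameLabel, Finset.mem_union, Finset.mem_filter] at *
      grind
    · have := Finset.card_union_le (N u) (N u')
      simp only [hN, r] at *
      omega
  push Not at c1 c2
  obtain ⟨x, hx⟩ : R₁.Nonempty := Finset.card_pos.1 (by omega)
  have hxX : x ∈ X := (Finset.mem_filter.1 hx).1
  obtain ⟨y, hy, hxy⟩ := exists_adj_of_card_gt (r := r) (v := x)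
    (by convert hmiss x hxX) (Finset.filter_subset _ _) c2
  have hyX : y ∈ X := (Finset.mem_filter.1 hy).1
  have hNx := hmiss x hxX
  have hNy := hmiss y hyX
  have hp : SameLabel g₁ x y := by
    simp only [hR₁, hR₂, r, SameLabel] at *
    grind
  refine (sum_le_of_subset_two_pieces (R := (N u ∪ N u') ∪ (N x ∪ N y)) hF0 hF1 hKX
      (Finset.filter_subset _ _) ?_ hKM (h₁ _ hp.1)).trans (hcard ?_)
  · intro z hz
    simp only [hK, hR₁, hR₂, hN, r, SameLabel, Finset.mem_union, Finset.mem_filter] at *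
    grind
  · have := Finset.card_union_le (N u) (N u')
    have := Finset.card_union_le (N x) (N y)
    have := Finset.card_union_le (N u ∪ N u') (N x ∪ N y)
    simp only [hN, r] at *
    omega

open scoped Classical in
/-- If almost every pair of vertices shares one of three labels, and every label class is light,
then the set is light. -/
lemma sum_mul_le_of_sameLabel {V κ₁ κ₂ κ₃ : Type*} {X : Finset V}
    {g₁ : V → Option κ₁} {g₂ : V → Option κ₂} {g₃ : V → Option κ₃} {f₁ f₂ f₃ : V → ℝ}
    {M : ℝ} {D : ℕ} (hM : 0 ≤ M)
    (hf₁ : ∀ v ∈ X, 0 ≤ f₁ v ∧ f₁ v ≤ 1) (hf₂ : ∀ v ∈ X, 0 ≤ f₂ v ∧ f₂ v ≤ 1)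
    (hf₃ : ∀ v ∈ X, 0 ≤ f₃ v ∧ f₃ v ≤ 1) (hhalf : ∀ v ∈ X, g₃ v ≠ none → f₃ v ≤ 1 / 2)
    (h₁ : ∀ a, a ≠ none → ∑ v ∈ X with g₁ v = a, f₁ v ≤ M)
    (h₂ : ∀ a, a ≠ none → ∑ v ∈ X with g₂ v = a, f₂ v ≤ M)
    (h₃ : ∀ a, a ≠ none → ∑ v ∈ X with g₃ v = a, f₃ v ≤ M)
    (hmiss : ∀ v ∈ X, (X.filter fun u =>
      ¬ (SameLabel g₁ v u ∨ SameLabel g₂ v u ∨ SameLabel g₃ v u)).card ≤ D) :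
    ∑ v ∈ X, f₁ v * f₂ v * f₃ v ≤ M + 4 * D := by
  set r : V → V → Prop := fun v u => SameLabel g₁ v u ∨ SameLabel g₂ v u ∨ SameLabel g₃ v u
  set N : V → Finset V := fun v => X.filter fun u => ¬ r v u with hN
  set F : V → ℝ := fun v => f₁ v * f₂ v * f₃ v with hF
  have hF0 : ∀ v ∈ X, 0 ≤ F v := fun v hv =>
    mul_nonneg (mul_nonneg (hf₁ v hv).1 (hf₂ v hv).1) (hf₃ v hv).1
  have hb12 : ∀ v ∈ X, f₁ v * f₂ v ≤ f₁ v ∧ f₁ v * f₂ v ≤ f₂ v ∧ 0 ≤ f₁ v * f₂ v := by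
    intro v hv
    have := hf₁ v hv
    have := hf₂ v hv
    refine ⟨?_, ?_, ?_⟩ <;> nlinarith
  have hFle : ∀ v ∈ X, F v ≤ f₁ v ∧ F v ≤ f₂ v ∧ F v ≤ f₃ v ∧ F v ≤ 1 := by
    intro v hv
    have h1 := hf₁ v hv
    have h2 := hf₂ v hv
    have h3 := hf₃ v hv
    have h := hb12 v hv
    have : F v ≤ f₁ v * f₂ v := by simp only [hF]; nlinarith
    have : F v ≤ f₃ v := by simp only [hF]; nlinarith
    refine ⟨?_, ?_, ?_, ?_⟩ <;> linarith
  have hFhalf : ∀ v ∈ X, f₃ v ≤ 1 / 2 → F v ≤ f₁ v / 2 ∧ F v ≤ f₂ v / 2 := by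
    intro v hv h
    have := hb12 v hv
    have : F v ≤ (f₁ v * f₂ v) * (1 / 2) := by simp only [hF]; nlinarith
    constructor <;> linarith
  have hFcls : ∀ {f : V → ℝ} {P : V → Prop}, (∀ v ∈ X, F v ≤ f v) → ∑ v ∈ X with P v, f v ≤ M →
      ∑ v ∈ X with P v, F v ≤ M := fun h h' =>
    (Finset.sum_le_sum fun v hv => h v (Finset.mem_filter.1 hv).1).trans h'
  have small : ∀ {A R : Finset V}, A ⊆ X → X ⊆ A ∪ R → ∑ v ∈ A, F v ≤ M → R.card ≤ 4 * D →
      ∑ v ∈ X, F v ≤ M + 4 * D := by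
    intro A R hA hX hAM hR
    have hR' : (R.card : ℝ) ≤ 4 * D := by exact_mod_cast hR
    have h : ∑ v ∈ X, F v ≤ ∑ v ∈ A, F v + ∑ v ∈ X \ A, F v := by
      rw [add_comm, Finset.sum_sdiff hA]
    have h' : ∑ v ∈ X \ A, F v ≤ ∑ v ∈ X \ A, (1 : ℝ) :=
      Finset.sum_le_sum fun v hv => (hFle v (Finset.mem_sdiff.1 hv).1).2.2.2
    have h'' : ((X \ A).card : ℝ) ≤ R.card := by
      refine Nat.cast_le.2 (Finset.card_le_card ?_)
      intro x hx
      have := hX (Finset.mem_sdiff.1 hx).1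
      simp only [Finset.mem_sdiff, Finset.mem_union] at *
      tauto
    simp only [Finset.sum_const, nsmul_eq_mul, mul_one] at h'
    linarith
  by_cases hv : ∃ v ∈ X, g₃ v = none
  · obtain ⟨v, hvX, hv3⟩ := hv
    have hNv := hmiss v hvX
    set K₁ := X.filter fun x => SameLabel g₁ v x with hK₁
    set K₂ := X.filter fun x => SameLabel g₂ v x with hK₂
    have hK₁M : ∑ x ∈ K₁, f₁ x ≤ M := by
      by_cases hg : g₁ v = none
      · simpa [hK₁, SameLabel, hg] using hM
      · simpa [hK₁, SameLabel, hg, eq_comm] using h₁ _ hg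
    have hK₂M : ∑ x ∈ K₂, f₂ x ≤ M := by
      by_cases hg : g₂ v = none
      · simpa [hK₂, SameLabel, hg] using hM
      · simpa [hK₂, SameLabel, hg, eq_comm] using h₂ _ hg
    have hcov : ∀ x ∈ X, x ∈ K₁ ∨ x ∈ K₂ ∨ x ∈ N v := by
      intro x hx
      simp only [hK₁, hK₂, hN, r, SameLabel] at *
      grind
    by_cases c1 : (K₁ \ K₂).card ≤ D
    · refine small (A := K₂) (R := (K₁ \ K₂) ∪ N v) (Finset.filter_subset _ _) ?_
        (hFcls (fun v hv => (hFle v hv).2.1) hK₂M) ?_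
      · intro x hx
        have := hcov x hx
        simp only [Finset.mem_union, Finset.mem_sdiff]
        tauto
      · have := Finset.card_union_le (K₁ \ K₂) (N v)
        simp only [hN, r] at *
        omega
    by_cases c2 : (K₂ \ K₁).card ≤ D
    · refine small (A := K₁) (R := (K₂ \ K₁) ∪ N v) (Finset.filter_subset _ _) ?_
        (hFcls (fun v hv => (hFle v hv).1) hK₁M) ?_
      · intro x hx
        have := hcov x hx
        simp only [Finset.mem_union, Finset.mem_sdiff]
        tauto
      · have := Finset.card_union_le (K₂ \ K₁) (N v)
        simp only [hN, r] at *
        omega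
    push Not at c1 c2
    have hP : ∀ x ∈ K₁ \ K₂, f₃ x ≤ 1 / 2 := by
      intro x hx
      have hxX : x ∈ X := (Finset.mem_filter.1 (Finset.mem_sdiff.1 hx).1).1
      obtain ⟨y, hy, hxy⟩ := exists_adj_of_card_gt (r := r) (v := x) (by convert hmiss x hxX)
        (Finset.sdiff_subset.trans (Finset.filter_subset _ _)) c2
      refine hhalf x hxX ?_
      simp only [hK₁, hK₂, r, SameLabel, Finset.mem_sdiff] at *
      grind
    have hQ : ∀ x ∈ K₂ \ K₁, f₃ x ≤ 1 / 2 := by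
      intro x hx
      have hxX : x ∈ X := (Finset.mem_filter.1 (Finset.mem_sdiff.1 hx).1).1
      obtain ⟨y, hy, hxy⟩ := exists_adj_of_card_gt (r := r) (v := x) (by convert hmiss x hxX)
        (Finset.sdiff_subset.trans (Finset.filter_subset _ _)) c1
      refine hhalf x hxX ?_
      simp only [hK₁, hK₂, r, SameLabel, Finset.mem_sdiff] at *
      grind
    set G : V → ℝ := fun x => (if x ∈ K₁ then f₁ x / 2 else 0) + (if x ∈ K₂ then f₂ x / 2 else 0) +
      (if x ∈ N v then 1 else 0) with hG
    have hFG : ∑ x ∈ X, F x ≤ ∑ x ∈ X, G x := by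
      refine Finset.sum_le_sum fun x hx => ?_
      have a1 := hFle x hx
      have a2 := hf₁ x hx
      have a3 := hf₂ x hx
      have a4 := hFhalf x hx
      have a5 := hP x
      have a6 := hQ x
      have a7 := hcov x hx
      simp only [Finset.mem_sdiff] at a5 a6
      simp only [hG]
      by_cases k1 : x ∈ K₁ <;> by_cases k2 : x ∈ K₂ <;> by_cases k3 : x ∈ N v <;>
        simp only [k1, k2, k3, if_true, if_false, not_true_eq_false, not_false_eq_true, and_true,
          and_false, forall_const, or_false, or_true, IsEmpty.forall_iff] at * <;>
        first | linarith | (have a8 := a4 a5; linarith) | (have a8 := a4 a6; linarith)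
    have hs1 : ∑ x ∈ X, (if x ∈ K₁ then f₁ x / 2 else 0) ≤ M / 2 := by
      rw [← Finset.sum_filter, Finset.filter_mem_eq_inter,
        Finset.inter_eq_right.2 (Finset.filter_subset _ _), ← Finset.sum_div]
      linarith
    have hs2 : ∑ x ∈ X, (if x ∈ K₂ then f₂ x / 2 else 0) ≤ M / 2 := by
      rw [← Finset.sum_filter, Finset.filter_mem_eq_inter,
        Finset.inter_eq_right.2 (Finset.filter_subset _ _), ← Finset.sum_div]
      linarith
    have hs3 : ∑ x ∈ X, (if x ∈ N v then (1 : ℝ) else 0) ≤ D := by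
      rw [← Finset.sum_filter, Finset.filter_mem_eq_inter,
        Finset.inter_eq_right.2 (Finset.filter_subset _ _)]
      simp only [Finset.sum_const, nsmul_eq_mul, mul_one]
      exact_mod_cast hNv
    have hsum : ∑ x ∈ X, G x ≤ M / 2 + M / 2 + D := by
      simp only [hG, Finset.sum_add_distrib]
      linarith
    have : (0 : ℝ) ≤ D := Nat.cast_nonneg _
    linarith
  push Not at hv
  have hf3 : ∀ v ∈ X, f₃ v ≤ 1 / 2 := fun v hvX => hhalf v hvX (hv v hvX)
  rcases X.eq_empty_or_nonempty with rfl | ⟨u, hu⟩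
  · simp only [Finset.sum_empty]
    positivity
  by_cases c : (X.filter fun x => g₃ x ≠ g₃ u).card ≤ D
  · refine small (A := X.filter fun x => g₃ x = g₃ u) (R := X.filter fun x => g₃ x ≠ g₃ u)
      (Finset.filter_subset _ _) ?_ ((Finset.sum_le_sum fun v hv =>
        (hFle v (Finset.mem_filter.1 hv).1).2.2.1).trans (h₃ _ (hv u hu))) (by omega)
    rw [Finset.filter_union_filter_not_eq]
  push Not at c
  obtain ⟨u', hu', huu'⟩ := exists_adj_of_card_gt (r := r) (v := u)
    (by convert hmiss u hu) (Finset.filter_subset _ _) c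
  obtain ⟨hu'X, h3⟩ := Finset.mem_filter.1 hu'
  have half₁ : ∀ a, a ≠ none → ∑ v ∈ X with g₁ v = a, F v ≤ M / 2 := by
    intro a ha
    calc ∑ v ∈ X with g₁ v = a, F v ≤ ∑ v ∈ X with g₁ v = a, f₁ v / 2 :=
          Finset.sum_le_sum fun v hv => have h := (Finset.mem_filter.1 hv).1
            (hFhalf v h (hf3 v h)).1
      _ ≤ M / 2 := by rw [← Finset.sum_div]; linarith [h₁ a ha]
  have half₂ : ∀ a, a ≠ none → ∑ v ∈ X with g₂ v = a, F v ≤ M / 2 := by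
    intro a ha
    calc ∑ v ∈ X with g₂ v = a, F v ≤ ∑ v ∈ X with g₂ v = a, f₂ v / 2 :=
          Finset.sum_le_sum fun v hv => have h := (Finset.mem_filter.1 hv).1
            (hFhalf v h (hf3 v h)).2
      _ ≤ M / 2 := by rw [← Finset.sum_div]; linarith [h₂ a ha]
  have hF1 : ∀ v ∈ X, F v ≤ 1 := fun v hv => (hFle v hv).2.2.2
  rcases huu' with h | h | h
  · exact sum_le_of_sameLabel_first hF0 hF1 half₁ half₂ hM hmiss hu hu'X (Ne.symm h3) h
  · refine sum_le_of_sameLabel_first (g₁ := g₂) (g₂ := g₁) (g₃ := g₃) hF0 hF1 half₂ half₁ hM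
      ?_ hu hu'X (Ne.symm h3) h
    intro v hv
    refine le_trans (le_of_eq ?_) (hmiss v hv)
    congr 1
    ext x
    simp only [Finset.mem_filter]
    tauto
  · exact absurd h.2.symm h3

/-- In a uniform pair of density at least `d`, every large set contains a vertex with many
neighbours in a prescribed large set. -/
lemma SimpleGraph.IsUniform.exists_many_neighbors {V : Type*} [DecidableEq V] {G : SimpleGraph V}
    [DecidableRel G.Adj] {ε d : ℝ} {s t S T : Finset V} (h : G.IsUniform ε s t)
    (hd : d ≤ G.edgeDensity s t) (hS : S ⊆ s) (hT : T ⊆ t) (hSn : S.Nonempty)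
    (hSc : (s.card : ℝ) * ε ≤ S.card) (hTc : (t.card : ℝ) * ε ≤ T.card) :
    ∃ y ∈ S, (d - ε) * T.card ≤ (T.filter (G.Adj y)).card := by
  by_contra! hc
  have hdens : d - ε < G.edgeDensity S T := by
    have := abs_lt.1 (h hS hT hSc hTc)
    linarith
  have hcard : ((G.interedges S T).card : ℝ) = ∑ y ∈ S, ((T.filter (G.Adj y)).card : ℝ) := by
    rw [← Nat.cast_sum]
    congr 1
    rw [SimpleGraph.interedges_def, Finset.card_filter, Finset.sum_product]
    refine Finset.sum_congr rfl fun y _ => ?_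
    rw [Finset.card_filter]
  have hlt : ((G.interedges S T).card : ℝ) < S.card * ((d - ε) * T.card) := by
    rw [hcard, ← nsmul_eq_mul, ← Finset.sum_const]
    exact Finset.sum_lt_sum_of_nonempty hSn hc
  have hTpos : 0 < (T.card : ℝ) := by
    rcases T.eq_empty_or_nonempty with rfl | hTn
    · simp only [Finset.card_empty, Nat.cast_zero, mul_zero] at hlt
      exact absurd hlt (not_lt.2 (Nat.cast_nonneg _))
    · exact_mod_cast hTn.card_pos
  have hSpos : 0 < (S.card : ℝ) := by exact_mod_cast hSn.card_pos
  rw [SimpleGraph.edgeDensity_def] at hdens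
  push_cast at hdens
  rw [lt_div_iff₀ (by positivity)] at hdens
  linarith

section Embedding

variable {V W : Type*} [DecidableEq V] [DecidableEq W] {G : SimpleGraph V} [DecidableRel G.Adj]
  {Γ : SimpleGraph W} {cl : W → Finset V} {ε d β : ℝ}

/-- A path of `G` can be extended along a walk in a graph of dense uniform pairs, as long as no
cluster gets exhausted. -/
lemma exists_path_along_walk (hε : 0 < ε) (hβ : 4 * ε ≤ (d - ε) * β) (hβ' : β ≤ 1 / 2) (hd1 : d ≤ 1)
    (hβ0 : 0 < β)
    (hdisj : ∀ A B v, v ∈ cl A → v ∈ cl B → A = B) (hne : ∀ A, (cl A).Nonempty)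
    (hΓ : ∀ A B, Γ.Adj A B → G.IsUniform ε (cl A) (cl B) ∧ d ≤ G.edgeDensity (cl A) (cl B))
    {S : Finset V} {v₀ : V} (hS : ∀ C, ((S ∩ cl C).card : ℝ) ≤ β / 2 * (cl C).card)
    {A B : W} (q : Γ.Walk A B) :
    ∀ {x : V} (P : G.Walk x v₀), P.IsPath → (∀ z ∈ P.support, z ∉ S) →
      (∀ C, (((cl C).filter (· ∈ P.support)).card + q.support.count C : ℝ) ≤
        (1 - β) * (cl C).card) →
      (ε * (cl A).card ≤
        ((cl A).filter fun y => G.Adj x y ∧ y ∉ P.support ∧ y ∉ S).card) →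
      ∃ (x' : V) (P' : G.Walk x' v₀), P'.IsPath ∧ (∀ z ∈ P'.support, z ∉ S) ∧
        P'.length = P.length + q.length ∧
        (ε * (cl B).card ≤
          ((cl B).filter fun y => G.Adj x' y ∧ y ∉ P'.support ∧ y ∉ S).card) := by
  have hdε : 0 < d - ε := by
    by_contra h
    have : (d - ε) * β ≤ 0 := mul_nonpos_of_nonpos_of_nonneg (by linarith) hβ0.le
    linarith
  induction q with
  | nil => exact fun P hP hPS _ hfree => ⟨_, P, hP, hPS, by simp, hfree⟩
  | @cons A A₁ B h q ih =>
    intro x P hP hPS hcount hfree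
    obtain ⟨huni, hdens⟩ := hΓ A A₁ h
    set F := (cl A).filter fun y => G.Adj x y ∧ y ∉ P.support ∧ y ∉ S with hF
    set T := (cl A₁).filter fun y => y ∉ P.support ∧ y ∉ S with hT
    have hApos : 0 < ((cl A).card : ℝ) := by exact_mod_cast (hne A).card_pos
    have hA₁pos : 0 < ((cl A₁).card : ℝ) := by exact_mod_cast (hne A₁).card_pos
    have hFn : F.Nonempty := by
      have : (0 : ℝ) < F.card := lt_of_lt_of_le (by positivity) hfree
      exact Finset.card_pos.1 (by exact_mod_cast this)
    have hTcard : β / 2 * (cl A₁).card ≤ T.card := by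
      have h1 := hcount A₁
      have h2 := hS A₁
      have h3 : (cl A₁).card ≤
          T.card + ((cl A₁).filter (· ∈ P.support)).card + (S ∩ cl A₁).card := by
        have : cl A₁ ⊆ T ∪ (cl A₁).filter (· ∈ P.support) ∪ (S ∩ cl A₁) := by
          intro y hy
          simp only [hT, Finset.mem_union, Finset.mem_filter, Finset.mem_inter]
          tauto
        refine (Finset.card_le_card this).trans ((Finset.card_union_le _ _).trans ?_)
        exact Nat.add_le_add_right (Finset.card_union_le _ _) _
      have h3' : ((cl A₁).card : ℝ) ≤
          T.card + ((cl A₁).filter (· ∈ P.support)).card + (S ∩ cl A₁).card := by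
        exact_mod_cast h3
      have h4 : (0 : ℝ) ≤ ((SimpleGraph.Walk.cons h q).support.count A₁ : ℝ) := Nat.cast_nonneg _
      linarith
    have hTε : ((cl A₁).card : ℝ) * ε ≤ T.card := by
      have : ε ≤ β / 2 := by nlinarith
      nlinarith
    obtain ⟨y, hyF, hy⟩ := huni.exists_many_neighbors hdens (Finset.filter_subset _ _)
      (Finset.filter_subset _ _) hFn (by linarith) hTε
    simp only [Finset.mem_filter] at hyF
    obtain ⟨hyA, hxy, hyP, hyS⟩ := hyF
    obtain ⟨x', P', h1, h2, h3, h4⟩ := ih (P.cons hxy.symm) (hP.cons hyP) (by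
        intro z hz
        rw [SimpleGraph.Walk.support_cons, List.mem_cons] at hz
        rcases hz with rfl | hz
        · exact hyS
        · exact hPS z hz) (by
        intro C
        refine le_trans ?_ (hcount C)
        norm_cast
        rw [SimpleGraph.Walk.support_cons, SimpleGraph.Walk.support_cons, List.count_cons]
        by_cases hC : A = C
        · subst hC
          have : (cl A).filter (· ∈ y :: P.support) ⊆
              insert y ((cl A).filter (· ∈ P.support)) := by
            intro z hz
            simp only [Finset.mem_filter, List.mem_cons, Finset.mem_insert] at *
            tauto
          have := (Finset.card_le_card this).trans (Finset.card_insert_le _ _)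
          simp only [beq_self_eq_true, if_true]
          omega
        · have : (cl C).filter (· ∈ y :: P.support) ⊆ (cl C).filter (· ∈ P.support) := by
            intro z hz
            simp only [Finset.mem_filter, List.mem_cons] at *
            refine ⟨hz.1, hz.2.resolve_left ?_⟩
            rintro rfl
            exact hC (hdisj _ _ _ hyA hz.1)
          have := Finset.card_le_card this
          omega) (by
        have : T.filter (G.Adj y) ⊆ (cl A₁).filter fun z => G.Adj y z ∧
            z ∉ (P.cons hxy.symm).support ∧ z ∉ S := by
          intro z hz
          simp only [hT, Finset.mem_filter, SimpleGraph.Walk.support_cons, List.mem_cons] at *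
          refine ⟨hz.1.1, hz.2, ?_, hz.1.2.2⟩
          rintro (rfl | h')
          · exact G.irrefl hz.2
          · exact hz.1.2.1 h'
        have h5 : ((T.filter (G.Adj y)).card : ℝ) ≤ _ := Nat.cast_le.2 (Finset.card_le_card this)
        refine le_trans ?_ h5
        refine le_trans ?_ hy
        have : (d - ε) * (β / 2 * (cl A₁).card) ≤ (d - ε) * T.card := by gcongr
        nlinarith)
    refine ⟨x', P', h1, h2, ?_, h4⟩
    rw [h3]
    simp only [SimpleGraph.Walk.length_cons]
    omega

/-- A closed walk in a graph of dense uniform pairs which does not exhaust any cluster gives rise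
to a cycle of `G`. -/
lemma exists_isCycle_of_closed_walk (hε : 0 < ε) (hβ : 4 * ε ≤ (d - ε) * β) (hβ' : β ≤ 1 / 2)
    (hd1 : d ≤ 1) (hβ0 : 0 < β)
    (hdisj : ∀ A B v, v ∈ cl A → v ∈ cl B → A = B) (hbig : ∀ A, 1 ≤ ε * (cl A).card)
    (hΓ : ∀ A B, Γ.Adj A B → G.IsUniform ε (cl A) (cl B) ∧ d ≤ G.edgeDensity (cl A) (cl B))
    {A B : W} (hAB : Γ.Adj A B) (w : Γ.Walk A A)
    (hcount : ∀ C, (w.support.count C + 2 : ℝ) ≤ (1 - β) * (cl C).card) :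
    ∃ (v : V) (c : G.Walk v v), c.IsCycle ∧ c.length = w.length + 4 := by
  have hdε : 0 < d - ε := by
    by_contra h
    have : (d - ε) * β ≤ 0 := mul_nonpos_of_nonpos_of_nonneg (by linarith) hβ0.le
    linarith
  have hne : ∀ A, (cl A).Nonempty := by
    intro A
    rw [← Finset.card_pos]
    by_contra h
    have := hbig A
    have h0 : (cl A).card = 0 := by omega
    rw [h0] at this
    norm_num at this
  have hd8 : 8 * ε ≤ d - ε := by nlinarith
  obtain ⟨huni, hdens⟩ := hΓ A B hAB
  have hε1 : ε ≤ 1 := by linarith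
  obtain ⟨v₀, hv₀, hv₀N⟩ := huni.exists_many_neighbors hdens (S := cl A) (T := cl B)
    subset_rfl subset_rfl (hne A) (mul_le_of_le_one_right (Nat.cast_nonneg _) hε1)
    (mul_le_of_le_one_right (Nat.cast_nonneg _) hε1)
  set a : ℝ := ((cl B).card : ℝ) with ha
  have hceil : (⌈ε * a⌉₊ : ℝ) ≤ 2 * ε * a := by
    have h1 := (Nat.ceil_lt_add_one (a := ε * a) (by positivity)).le
    have h2 := hbig B
    linarith
  have ha0 : 0 ≤ a := Nat.cast_nonneg _
  obtain ⟨S, hSsub, hScard⟩ := Finset.exists_subset_card_eq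
    (s := (cl B).filter (G.Adj v₀)) (n := ⌈ε * a⌉₊) (by
      have : (⌈ε * a⌉₊ : ℝ) ≤ ((cl B).filter (G.Adj v₀)).card := by nlinarith
      exact_mod_cast this)
  have hSB : ∀ z ∈ S, z ∈ cl B ∧ G.Adj v₀ z := fun z hz => Finset.mem_filter.1 (hSsub hz)
  have hScap : ∀ C, ((S ∩ cl C).card : ℝ) ≤ β / 2 * (cl C).card := by
    intro C
    by_cases hC : C = B
    · subst hC
      have : ((S ∩ cl C).card : ℝ) ≤ S.card :=
        Nat.cast_le.2 (Finset.card_le_card Finset.inter_subset_left)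
      rw [hScard] at this
      have : 4 * ε ≤ β := by nlinarith
      nlinarith
    · have : S ∩ cl C = ∅ := by
        ext z
        simp only [Finset.mem_inter, Finset.notMem_empty, iff_false, not_and]
        exact fun hz hzC => hC (hdisj _ _ _ hzC (hSB z hz).1)
      rw [this]
      simp only [Finset.card_empty, Nat.cast_zero]
      positivity
  obtain ⟨x, P, hP, hPS, hlen, hfree⟩ := exists_path_along_walk hε hβ hβ' hd1 hβ0 hdisj hne hΓ hScap
    (w.cons hAB.symm) (SimpleGraph.Walk.nil (u := v₀)) (SimpleGraph.Walk.IsPath.nil) (by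
      intro z hz hzS
      simp only [SimpleGraph.Walk.support_nil, List.mem_singleton] at hz
      subst hz
      exact G.irrefl (hSB _ hzS).2) (by
      intro C
      refine le_trans ?_ (hcount C)
      norm_cast
      rw [SimpleGraph.Walk.support_cons, List.count_cons]
      have : ((cl C).filter (· ∈ (SimpleGraph.Walk.nil (G := G) (u := v₀)).support)).card ≤ 1 := by
        refine (Finset.card_le_card (t := {v₀}) ?_).trans (by simp)
        intro z hz
        simpa using (Finset.mem_filter.1 hz).2
      split_ifs <;> omega) (by
      have hsub : (cl B).filter (G.Adj v₀) \ S ⊆ (cl B).filter fun y => G.Adj v₀ y ∧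
          y ∉ (SimpleGraph.Walk.nil (G := G) (u := v₀)).support ∧ y ∉ S := by
        intro z hz
        simp only [Finset.mem_sdiff, Finset.mem_filter, SimpleGraph.Walk.support_nil,
          List.mem_singleton] at *
        exact ⟨hz.1.1, hz.1.2, hz.1.2.ne', hz.2⟩
      have h1 : ((((cl B).filter (G.Adj v₀)) \ S).card : ℝ) ≤ _ :=
        Nat.cast_le.2 (Finset.card_le_card hsub)
      refine le_trans ?_ h1
      rw [Finset.cast_card_sdiff hSsub, hScard]
      nlinarith)
  have hApos : 0 < ((cl A).card : ℝ) := by exact_mod_cast (hne A).card_pos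
  set F := (cl A).filter fun y => G.Adj x y ∧ y ∉ P.support ∧ y ∉ S with hF
  have hFn : F.Nonempty := by
    have : (0 : ℝ) < F.card := lt_of_lt_of_le (by positivity) hfree
    exact Finset.card_pos.1 (by exact_mod_cast this)
  obtain ⟨y, hyF, hy⟩ := huni.exists_many_neighbors hdens (S := F) (T := S)
    (Finset.filter_subset _ _) (fun z hz => (hSB z hz).1) hFn (by linarith)
    (by rw [hScard]; have := Nat.le_ceil (ε * a); linarith)
  simp only [hF, Finset.mem_filter] at hyF
  obtain ⟨hyA, hxy, hyP, hyS⟩ := hyF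
  have hSpos : (0 : ℝ) < S.card := by
    rw [hScard]
    have := Nat.le_ceil (ε * a)
    have := hbig B
    linarith
  have hpos : (0 : ℝ) < (S.filter (G.Adj y)).card := lt_of_lt_of_le (by positivity) hy
  obtain ⟨z, hz⟩ : (S.filter (G.Adj y)).Nonempty := Finset.card_pos.1 (by exact_mod_cast hpos)
  obtain ⟨hzS, hyz⟩ := Finset.mem_filter.1 hz
  have hzP : z ∉ P.support := fun h => hPS z h hzS
  have hPy : (P.cons hxy.symm).IsPath := hP.cons hyP
  have hPz : ((P.cons hxy.symm).cons hyz.symm).IsPath := hPy.cons (by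
    simp only [SimpleGraph.Walk.support_cons, List.mem_cons, not_or]
    exact ⟨hyz.ne', hzP⟩)
  refine ⟨v₀, ((P.cons hxy.symm).cons hyz.symm).cons (hSB z hzS).2, ?_, ?_⟩
  · rw [SimpleGraph.Walk.cons_isCycle_iff]
    refine ⟨hPz, ?_⟩
    simp only [SimpleGraph.Walk.edges_cons, List.mem_cons, not_or]
    refine ⟨?_, ?_, fun h => hzP (P.snd_mem_support_of_mem_edges h)⟩
    · intro h
      rw [Sym2.eq_iff] at h
      rcases h with h | h
      · exact hyz.ne h.2.symm
      · exact hyP (h.1 ▸ P.end_mem_support)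
    · intro h
      rw [Sym2.eq_iff] at h
      rcases h with h | h
      · exact hzP (h.2 ▸ P.start_mem_support)
      · exact hyz.ne h.2.symm
  · simp only [SimpleGraph.Walk.length_cons, SimpleGraph.Walk.length_nil] at *
    omega

end Embedding

section ClosedWalk

variable {W : Type*} [DecidableEq W] {Γ : SimpleGraph W}

lemma SimpleGraph.Walk.count_tail_support_append {u v w : W} (p : Γ.Walk u v) (q : Γ.Walk v w)
    (C : W) :
    (p.append q).support.tail.count C = p.support.tail.count C + q.support.tail.count C := by
  rw [SimpleGraph.Walk.tail_support_append, List.count_append]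

lemma SimpleGraph.Walk.count_tail_support_le {u v : W} (p : Γ.Walk u v) (C : W) :
    p.support.tail.count C ≤ p.length := by
  refine List.count_le_length.trans ?_
  simp

/-- A walk going back and forth along an edge. -/
lemma exists_oscillating_walk {x y : W} (h : Γ.Adj x y) (t : ℕ) :
    ∃ w : Γ.Walk x x, w.length = 2 * t ∧
      ∀ C, w.support.tail.count C ≤ t * ((if x = C then 1 else 0) + if y = C then 1 else 0) := by
  induction t with
  | zero => exact ⟨.nil, by simp⟩
  | succ t ih =>
    obtain ⟨w, hw, hc⟩ := ih
    refine ⟨(SimpleGraph.Walk.cons h (.cons h.symm .nil)).append w, ?_, fun C => ?_⟩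
    · rw [SimpleGraph.Walk.length_append, hw]
      simp only [SimpleGraph.Walk.length_cons, SimpleGraph.Walk.length_nil]
      ring
    · rw [SimpleGraph.Walk.count_tail_support_append]
      have := hc C
      simp only [SimpleGraph.Walk.support_cons, SimpleGraph.Walk.support_nil, List.tail_cons,
        List.count_cons, List.count_nil, beq_iff_eq]
      rw [add_mul]
      split_ifs at * <;> omega

/-- A closed walk of prescribed length, going back and forth at most `T` times along each edge
`x — φ x`. -/
lemma exists_closed_walk_of_injOn {r : W} {s : Finset W} {φ : W → W} {len : W → ℕ} {T : ℕ}
    (hlen : ∀ x ∈ s, ∃ p : Γ.Walk r x, p.length = len x) (hadj : ∀ x ∈ s, Γ.Adj x (φ x))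
    (w₀ : Γ.Walk r r) {m : ℕ} (hm : m ≤ s.card * T) :
    ∃ w : Γ.Walk r r, w.length = w₀.length + ∑ x ∈ s, 2 * len x + 2 * m ∧
      ∀ C, w.support.tail.count C ≤ w₀.length + ∑ x ∈ s, 2 * len x +
        ∑ x ∈ s, T * ((if x = C then 1 else 0) + if φ x = C then 1 else 0) := by
  induction s using Finset.induction_on generalizing m with
  | empty =>
    refine ⟨w₀, ?_, fun C => ?_⟩
    · simp only [Finset.card_empty, zero_mul, nonpos_iff_eq_zero] at hm
      simp [hm]
    · simpa using w₀.count_tail_support_le C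
  | insert a s ha ih =>
    rw [Finset.card_insert_of_notMem ha, add_mul, one_mul] at hm
    obtain ⟨w, hw, hc⟩ := ih (m := min m (s.card * T))
      (fun x hx => hlen x (Finset.mem_insert_of_mem hx))
      (fun x hx => hadj x (Finset.mem_insert_of_mem hx)) (min_le_right _ _)
    obtain ⟨p, hp⟩ := hlen a (Finset.mem_insert_self _ _)
    obtain ⟨o, ho, hoc⟩ := exists_oscillating_walk (hadj a (Finset.mem_insert_self _ _))
      (m - min m (s.card * T))
    refine ⟨(p.append (o.append p.reverse)).append w, ?_, fun C => ?_⟩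
    · simp only [SimpleGraph.Walk.length_append, SimpleGraph.Walk.length_reverse, hw, ho, hp]
      rw [Finset.sum_insert ha]
      omega
    · simp only [SimpleGraph.Walk.count_tail_support_append]
      rw [Finset.sum_insert ha, Finset.sum_insert ha]
      have h1 := p.count_tail_support_le C
      have h2 := p.reverse.count_tail_support_le C
      rw [SimpleGraph.Walk.length_reverse] at h2
      have h3 := hc C
      have h4 := (hoc C).trans (Nat.mul_le_mul_right _ (by omega : _ ≤ T))
      omega

/-- A closed walk of prescribed length passing at most `2 * T` times, up to a constant, through
each vertex. -/
lemma exists_closed_walk_count_le {r : W} {s : Finset W} {φ : W → W} {len : W → ℕ} {T : ℕ}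
    (hlen : ∀ x ∈ s, ∃ p : Γ.Walk r x, p.length = len x) (hadj : ∀ x ∈ s, Γ.Adj x (φ x))
    (hinj : Set.InjOn φ s) (w₀ : Γ.Walk r r) {m : ℕ} (hm : m ≤ s.card * T) :
    ∃ w : Γ.Walk r r, w.length = w₀.length + ∑ x ∈ s, 2 * len x + 2 * m ∧
      ∀ C, w.support.count C ≤ w₀.length + 1 + ∑ x ∈ s, 2 * len x + 2 * T := by
  obtain ⟨w, hw, hc⟩ := exists_closed_walk_of_injOn hlen hadj w₀ hm
  refine ⟨w, hw, fun C => ?_⟩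
  have h1 : ∑ x ∈ s, (if x = C then 1 else 0) ≤ 1 := by
    rw [Finset.sum_ite_eq']
    split_ifs <;> simp
  have h2 : ∑ x ∈ s, (if φ x = C then 1 else 0) ≤ 1 := by
    rw [← Finset.card_filter, Finset.card_le_one]
    intro x hx y hy
    simp only [Finset.mem_filter] at hx hy
    exact hinj hx.1 hy.1 (hx.2.trans hy.2.symm)
  have h3 : w.support.count C ≤ w.support.tail.count C + 1 := by
    rw [← w.cons_tail_support, List.tail_cons, List.count_cons]
    split_ifs <;> simp
  have h4 := hc C
  have h6 : ∑ x ∈ s, T * ((if x = C then 1 else 0) + if φ x = C then 1 else 0) =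
      T * (∑ x ∈ s, (if x = C then 1 else 0) + ∑ x ∈ s, (if φ x = C then 1 else 0)) := by
    rw [← Finset.mul_sum, Finset.sum_add_distrib]
  have h5 : T * (∑ x ∈ s, (if x = C then 1 else 0) + ∑ x ∈ s, (if φ x = C then 1 else 0)) ≤ T * 2 :=
    Nat.mul_le_mul_left _ (by omega)
  omega

end ClosedWalk

open scoped Classical in
/-- The deficiency version of Hall's theorem, inside a set of vertices of a graph. -/
lemma exists_partial_matching_of_deficiency {W : Type*} [Fintype W] (Γ : SimpleGraph W)
    (C : Finset W) :
    ∃ S ⊆ C, ∃ D ⊆ C, ∃ φ : W → W, (∀ x ∈ D, Γ.Adj x (φ x)) ∧ Set.InjOn φ D ∧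
      C.card + (Finset.univ.filter fun y => ∃ x ∈ S, Γ.Adj x y).card ≤ D.card + S.card := by
  let nb : Finset W → Finset W := fun S => Finset.univ.filter fun y => ∃ x ∈ S, Γ.Adj x y
  obtain ⟨S, hS, hmax⟩ := Finset.exists_max_image C.powerset
    (fun S => (S.card : ℤ) - (nb S).card) ⟨∅, Finset.empty_mem_powerset _⟩
  rw [Finset.mem_powerset] at hS
  have h0 := hmax ∅ (Finset.empty_mem_powerset _)
  have hnb0 : nb ∅ = ∅ := by simp [nb]
  rw [hnb0, Finset.card_empty] at h0
  obtain ⟨d, hd⟩ : ∃ d : ℕ, (S.card : ℤ) = (nb S).card + d :=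
    ⟨S.card - (nb S).card, by omega⟩
  let t : C → Finset (W ⊕ Fin d) := fun x => (nb {x.1}).disjSum Finset.univ
  have hall : ∀ s : Finset C, s.card ≤ (s.biUnion t).card := by
    intro s
    rcases s.eq_empty_or_nonempty with rfl | ⟨x₀, hx₀⟩
    · simp
    have hsub : (nb (s.map (Function.Embedding.subtype _))).disjSum
        (Finset.univ : Finset (Fin d)) ⊆ s.biUnion t := by
      intro z hz
      rw [Finset.mem_biUnion]
      rcases z with y | i
      · rw [Finset.inl_mem_disjSum] at hz
        simp only [nb, Finset.mem_filter, Finset.mem_univ, true_and, Finset.mem_map,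
          Function.Embedding.subtype_apply] at hz
        obtain ⟨_, ⟨x, hx, rfl⟩, hxy⟩ := hz
        refine ⟨x, hx, ?_⟩
        simp only [t, nb, Finset.inl_mem_disjSum, Finset.mem_filter, Finset.mem_univ, true_and,
          Finset.mem_singleton, exists_eq_left]
        exact hxy
      · exact ⟨x₀, hx₀, by simp [t]⟩
    have h1 := Finset.card_le_card hsub
    rw [Finset.card_disjSum, Finset.card_univ, Fintype.card_fin] at h1
    have h2 := hmax (s.map (Function.Embedding.subtype _)) (by
      rw [Finset.mem_powerset]
      intro z hz
      simp only [Finset.mem_map, Function.Embedding.subtype_apply] at hz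
      obtain ⟨x, -, rfl⟩ := hz
      exact x.2)
    rw [Finset.card_map] at h2
    omega
  obtain ⟨f, hf, hft⟩ := (Finset.all_card_le_biUnion_card_iff_exists_injective t).1 hall
  let g : W → W := fun x => if h : x ∈ C then (f ⟨x, h⟩).elim id (fun _ => x) else x
  let D₀ : Finset C := Finset.univ.filter fun x => (f x).isLeft
  have hg : ∀ x ∈ D₀, f x = Sum.inl (g x.1) := by
    intro x hx
    simp only [D₀, Finset.mem_filter, Finset.mem_univ, true_and] at hx
    obtain ⟨y, hy⟩ := Sum.isLeft_iff.1 hx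
    simp only [g, x.2, dif_pos, Subtype.coe_eta, hy, Sum.elim_inl, id]
  refine ⟨S, hS, D₀.map (Function.Embedding.subtype _), ?_, g, ?_, ?_, ?_⟩
  · intro z hz
    simp only [Finset.mem_map, Function.Embedding.subtype_apply] at hz
    obtain ⟨x, -, rfl⟩ := hz
    exact x.2
  · intro z hz
    simp only [Finset.mem_map, Function.Embedding.subtype_apply] at hz
    obtain ⟨x, hx, rfl⟩ := hz
    have := hft x
    rw [hg x hx] at this
    simpa [t, nb] using this
  · intro z hz z' hz' hzz
    simp only [Finset.coe_map, Set.mem_image, Finset.mem_coe,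
      Function.Embedding.subtype_apply] at hz hz'
    obtain ⟨x, hx, rfl⟩ := hz
    obtain ⟨x', hx', rfl⟩ := hz'
    have := hf ((hg x hx).trans ((congrArg Sum.inl hzz).trans (hg x' hx').symm))
    rw [this]
  · rw [Finset.card_map]
    have h1 : D₀.card + (Finset.univ.filter fun x : C => ¬ (f x).isLeft).card = C.card := by
      rw [Finset.card_filter_add_card_filter_not, Finset.card_univ, Fintype.card_coe]
    have h2 : (Finset.univ.filter fun x : C => ¬ (f x).isLeft).card ≤ d := by
      have : ((Finset.univ.filter fun x : C => ¬ (f x).isLeft).map ⟨f, hf⟩) ⊆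
          (∅ : Finset W).disjSum (Finset.univ : Finset (Fin d)) := by
        intro z hz
        simp only [Finset.mem_map, Finset.mem_filter, Finset.mem_univ, true_and,
          Function.Embedding.coeFn_mk] at hz
        obtain ⟨x, hx, rfl⟩ := hz
        rcases h : f x with y | i
        · simp [h] at hx
        · simp
      have := Finset.card_le_card this
      rwa [Finset.card_map, Finset.card_disjSum, Finset.card_empty, zero_add, Finset.card_univ,
        Fintype.card_fin] at this
    change C.card + (nb S).card ≤ D₀.card + S.card
    omega

/-- The role of a vertex in its component: a side of a bipartite component, or a part of the
decomposition of a non-bipartite component given by a set of maximal deficiency. -/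
inductive VertexRole
  | left
  | right
  | outer
  | half
  | inner

/-- The pairs of roles which adjacent vertices may have. -/
def VertexRole.Compat : VertexRole → VertexRole → Prop
  | left, right => True
  | right, left => True
  | half, half => True
  | half, inner => True
  | inner, half => True
  | inner, inner => True
  | outer, inner => True
  | inner, outer => True
  | _, _ => False

section Roles

variable {W : Type*} [Fintype W] (Γ : SimpleGraph W)

lemma SimpleGraph.Reachable.dist_lt_card {Γ : SimpleGraph W} {x y : W} (h : Γ.Reachable x y) :
    Γ.dist x y < Fintype.card W := by
  obtain ⟨p, hp, hl⟩ := h.exists_path_of_dist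
  exact hl ▸ hp.length_lt

open scoped Classical in
/-- A non-bipartite connected component contains closed walks of all odd lengths up to a bound
given by its deficiency, visiting all vertices about equally often. -/
lemma exists_closed_walks_of_component (c : Γ.ConnectedComponent) {A B : W} (hAB : Γ.Adj A B)
    (hA : Γ.connectedComponentMk A = c)
    (hpar : (Γ.dist c.out A + Γ.dist c.out B) % 2 = 0)
    {D : Finset W} (hD : ∀ x ∈ D, Γ.connectedComponentMk x = c) {φ : W → W}
    (hφ : ∀ x ∈ D, Γ.Adj x (φ x)) (hinj : Set.InjOn φ D) :
    ∃ k : ℕ, k ≤ (Fintype.card W + 1) ^ 2 ∧ ∀ T m : ℕ, m ≤ D.card * T →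
      ∃ (r r' : W) (_ : Γ.Adj r r') (w : Γ.Walk r r), w.length = 2 * k + 1 + 2 * m ∧
        ∀ C, w.support.count C ≤ 2 * k + 2 + 2 * T := by
  have hreach : ∀ x, Γ.connectedComponentMk x = c → Γ.Reachable c.out x := by
    intro x hx
    rw [← SimpleGraph.ConnectedComponent.eq, hx]
    exact Quot.out_eq c
  have hB : Γ.connectedComponentMk B = c := by
    rw [← hA]
    exact (SimpleGraph.ConnectedComponent.sound hAB.reachable).symm
  obtain ⟨p, hp⟩ := (hreach A hA).exists_walk_length_eq_dist
  obtain ⟨q, hq⟩ := (hreach B hB).exists_walk_length_eq_dist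
  have hpl := (hreach A hA).dist_lt_card
  have hql := (hreach B hB).dist_lt_card
  have hw₀ : ((p.append (.cons hAB .nil)).append q.reverse).length =
      Γ.dist c.out A + Γ.dist c.out B + 1 := by
    simp only [SimpleGraph.Walk.length_append, SimpleGraph.Walk.length_reverse, hp, hq,
      SimpleGraph.Walk.length_cons, SimpleGraph.Walk.length_nil]
    omega
  set w₀ := (p.append (.cons hAB .nil)).append q.reverse
  obtain ⟨r', hr'⟩ : ∃ r', Γ.Adj c.out r' := by
    have : ¬ w₀.Nil := by
      rw [← SimpleGraph.Walk.length_eq_zero_iff]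
      omega
    exact ⟨_, w₀.adj_snd this⟩
  have hsum : ∑ x ∈ D, Γ.dist c.out x ≤ Fintype.card W * Fintype.card W := by
    refine (Finset.sum_le_card_nsmul _ _ _ fun x hx =>
      (hreach x (hD x hx)).dist_lt_card.le).trans ?_
    rw [smul_eq_mul]
    exact Nat.mul_le_mul_right _ (Finset.card_le_univ _)
  refine ⟨(Γ.dist c.out A + Γ.dist c.out B) / 2 + ∑ x ∈ D, Γ.dist c.out x, by
    nlinarith [Nat.div_mul_le_self (Γ.dist c.out A + Γ.dist c.out B) 2], fun T m hm => ?_⟩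
  obtain ⟨w, hw, hwc⟩ := exists_closed_walk_count_le
    (fun x hx => (hreach x (hD x hx)).exists_walk_length_eq_dist) hφ hinj w₀ hm
  refine ⟨_, r', hr', w, ?_, fun C => (hwc C).trans ?_⟩
  · rw [hw, hw₀, ← Finset.mul_sum]
    omega
  · rw [hw₀, ← Finset.mul_sum]
    omega

open scoped Classical in
lemma exists_vertexRole : ∃ typ : W → VertexRole,
    (∀ A B, Γ.Adj A B → (typ A).Compat (typ B)) ∧
    (Finset.univ.filter fun A => typ A = .inner).card ≤
      (Finset.univ.filter fun A => typ A = .outer).card ∧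
    ∀ c : Γ.ConnectedComponent,
      (∀ A, Γ.connectedComponentMk A = c → typ A ≠ .half ∧ typ A ≠ .inner) ∨
      ∃ q k : ℕ, q ≤ Fintype.card W ∧
        (Finset.univ.filter fun A => Γ.connectedComponentMk A = c ∧ typ A = .half).card +
          2 * (Finset.univ.filter fun A => Γ.connectedComponentMk A = c ∧ typ A = .inner).card ≤ q ∧
        k ≤ (Fintype.card W + 1) ^ 2 ∧ ∀ T m : ℕ, m ≤ q * T →
        ∃ (r r' : W) (_ : Γ.Adj r r') (w : Γ.Walk r r), w.length = 2 * k + 1 + 2 * m ∧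
          ∀ C, w.support.count C ≤ 2 * k + 2 + 2 * T := by
  let comp : Γ.ConnectedComponent → Finset W := fun c =>
    Finset.univ.filter fun A => Γ.connectedComponentMk A = c
  have hcomp : ∀ c A, A ∈ comp c ↔ Γ.connectedComponentMk A = c := by simp [comp]
  choose S hS D hD φ hφ hinj hcard using fun c => exists_partial_matching_of_deficiency Γ (comp c)
  let nb : Γ.ConnectedComponent → Finset W := fun c =>
    Finset.univ.filter fun y => ∃ x ∈ S c, Γ.Adj x y
  have hnb : ∀ c, nb c ⊆ comp c := by
    intro c y hy
    simp only [nb, Finset.mem_filter, Finset.mem_univ, true_and] at hy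
    obtain ⟨x, hx, hxy⟩ := hy
    rw [hcomp, ← (hcomp c x).1 (hS c hx)]
    exact (SimpleGraph.ConnectedComponent.sound hxy.reachable).symm
  have hmem : ∀ c x y, x ∈ S c → Γ.Adj x y → y ∈ nb c := fun c x y hx hxy => by
    simp only [nb, Finset.mem_filter, Finset.mem_univ, true_and]
    exact ⟨x, hx, hxy⟩
  let bip : Γ.ConnectedComponent → Prop := fun c => ∀ A B, Γ.Adj A B →
    Γ.connectedComponentMk A = c → (Γ.dist c.out A + Γ.dist c.out B) % 2 = 1
  let role : Γ.ConnectedComponent → W → VertexRole := fun c x =>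
    if bip c then (if Γ.dist c.out x % 2 = 0 then .left else .right)
    else if x ∈ S c then (if x ∈ nb c then .half else .outer)
    else if x ∈ nb c then .inner else .half
  have hbipr : ∀ c x, bip c → role c x = .left ∨ role c x = .right := by
    intro c x hc
    simp only [role, if_pos hc]
    split_ifs <;> simp
  have hinner : ∀ c, ¬ bip c → (Finset.univ.filter fun A => Γ.connectedComponentMk A = c ∧
      role (Γ.connectedComponentMk A) A = .inner) = nb c \ S c := by
    intro c hc
    ext x
    simp only [Finset.mem_filter, Finset.mem_univ, true_and, Finset.mem_sdiff]
    constructor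
    · rintro ⟨rfl, h⟩
      simp only [role, if_neg hc] at h
      split_ifs at h
      simp_all
    · rintro ⟨h1, h2⟩
      have h3 := (hcomp c x).1 (hnb c h1)
      refine ⟨h3, ?_⟩
      rw [h3]
      simp only [role, if_neg hc, if_neg h2, if_pos h1]
  have houter : ∀ c, ¬ bip c → (Finset.univ.filter fun A => Γ.connectedComponentMk A = c ∧
      role (Γ.connectedComponentMk A) A = .outer) = S c \ nb c := by
    intro c hc
    ext x
    simp only [Finset.mem_filter, Finset.mem_univ, true_and, Finset.mem_sdiff]
    constructor
    · rintro ⟨rfl, h⟩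
      simp only [role, if_neg hc] at h
      split_ifs at h
      simp_all
    · rintro ⟨h1, h2⟩
      have h3 := (hcomp c x).1 (hS c h1)
      refine ⟨h3, ?_⟩
      rw [h3]
      simp only [role, if_neg hc, if_neg h2, if_pos h1]
  have hSN : ∀ c, (nb c \ S c).card + (S c).card = (S c \ nb c).card + (nb c).card := by
    intro c
    rw [Finset.card_sdiff_add_card, Finset.card_sdiff_add_card, Finset.union_comm]
  refine ⟨fun x => role (Γ.connectedComponentMk x) x, ?_, ?_, ?_⟩
  · intro A B hAB
    have hc : Γ.connectedComponentMk A = Γ.connectedComponentMk B :=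
      SimpleGraph.ConnectedComponent.sound hAB.reachable
    simp only [← hc]
    set c := Γ.connectedComponentMk A with hcA
    by_cases hb : bip c
    · have := hb A B hAB hcA.symm
      simp only [role, if_pos hb]
      split_ifs
      · omega
      · trivial
      · trivial
      · omega
    · have h1 := hmem c A B
      have h2 := hmem c B A
      simp only [role, if_neg hb]
      split_ifs <;> first | trivial | (exfalso; simp_all [hAB.symm])
  · rw [Finset.card_eq_sum_card_fiberwise (f := Γ.connectedComponentMk) (t := Finset.univ)
      (fun _ _ => Finset.mem_coe.2 (Finset.mem_univ _)),
      Finset.card_eq_sum_card_fiberwise (f := Γ.connectedComponentMk) (t := Finset.univ)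
      (fun _ _ => Finset.mem_coe.2 (Finset.mem_univ _))]
    refine Finset.sum_le_sum fun c _ => ?_
    simp only [Finset.filter_filter, and_comm]
    by_cases hb : bip c
    · rw [Finset.filter_false_of_mem]
      · simp
      · rintro x - ⟨rfl, h⟩
        rcases hbipr _ x hb with h' | h' <;> simp [h'] at h
    · rw [hinner c hb, houter c hb]
      have := hSN c
      have h1 := hcard c
      have := Finset.card_le_card (hD c)
      change (comp c).card + (nb c).card ≤ _ at h1
      omega
  · intro c
    by_cases hb : bip c
    · left
      rintro A rfl
      rcases hbipr _ A hb with h' | h' <;> simp [h']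
    · right
      have hb' := hb
      simp only [bip] at hb'
      push Not at hb'
      obtain ⟨A, B, hAB, hA, hpar⟩ := hb'
      obtain ⟨k, hk, hw⟩ := exists_closed_walks_of_component Γ c hAB hA (by omega)
        (D := D c) (fun x hx => (hcomp c x).1 (hD c hx)) (hφ c) (hinj c)
      refine ⟨(D c).card, k, Finset.card_le_univ _, ?_, hk, hw⟩
      have h3 : (Finset.univ.filter fun A => Γ.connectedComponentMk A = c ∧
          role (Γ.connectedComponentMk A) A = .half).card + (nb c \ S c).card + (S c \ nb c).card
          ≤ (comp c).card := by
        rw [← hinner c hb, ← houter c hb, ← Finset.card_union_of_disjoint,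
          ← Finset.card_union_of_disjoint]
        · refine Finset.card_le_card ?_
          intro x
          simp only [Finset.mem_union, Finset.mem_filter, Finset.mem_univ, true_and, hcomp]
          tauto
        · rw [Finset.disjoint_left]
          intro x
          simp only [Finset.mem_union, Finset.mem_filter, Finset.mem_univ, true_and]
          rintro (⟨-, h⟩ | ⟨-, h⟩) ⟨-, h'⟩ <;> simp [h] at h'
        · rw [Finset.disjoint_left]
          intro x
          simp only [Finset.mem_filter, Finset.mem_univ, true_and]
          rintro ⟨-, h⟩ ⟨-, h'⟩
          simp [h] at h'
      dsimp only
      rw [hinner c hb]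
      have := hSN c
      have := hcard c
      change (comp c).card + (nb c).card ≤ _ at this
      omega

end Roles

open scoped Classical in
/-- A form of the regularity lemma: the vertices are mapped to clusters of about the same size, and
few edges lie outside the dense uniform pairs. -/
lemma SimpleGraph.exists_regular_clusters {V : Type} [Fintype V] [Nonempty V] (G : SimpleGraph V)
    {η ε d : ℝ} (hη : 0 < η) (hε : 0 < ε) (hd : 0 ≤ d) {l : ℕ} (hl : l ≤ Fintype.card V)
    (hηl : 4 / η ≤ l) :
    ∃ (W : Type) (_ : Fintype W) (cl : W → Finset V) (π : V → W),
      Fintype.card W ≤ SzemerediRegularity.bound ε l ∧ (∀ A v, v ∈ cl A ↔ π v = A) ∧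
      (∀ A, Fintype.card V / Fintype.card W ≤ (cl A).card ∧
        (cl A).card ≤ Fintype.card V / Fintype.card W + 1) ∧
      ((Finset.univ.filter fun e : V × V => G.Adj e.1 e.2 ∧ ¬ (π e.1 ≠ π e.2 ∧
        G.IsUniform ε (cl (π e.1)) (cl (π e.2)) ∧
        d ≤ G.edgeDensity (cl (π e.1)) (cl (π e.2)))).card : ℝ) ≤
          (4 * ε + η / 2 + 4 * d) * (Fintype.card V : ℝ) ^ 2 := by
  obtain ⟨P, hP, hlP, hPb, hPu⟩ := szemeredi_regularity G hε hl
  refine ⟨P.parts, inferInstance, Subtype.val,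
    fun v => ⟨P.part v, P.part_mem.2 (Finset.mem_univ v)⟩,
    by rwa [Fintype.card_coe], ?_, ?_, ?_⟩
  · rintro ⟨A, hA⟩ v
    rw [Subtype.mk.injEq]
    exact (P.part_eq_iff_mem hA).symm
  · rintro ⟨A, hA⟩
    rw [Fintype.card_coe]
    exact ⟨hP.average_le_card_part hA, hP.card_part_le_average_add_one hA⟩
  · let E₁ := (P.nonUniforms G ε).biUnion fun (U, V) ↦ U ×ˢ V
    let E₂ := P.parts.biUnion Finset.offDiag
    let E₃ := (P.sparsePairs G d).biUnion fun (U, V) ↦ G.interedges U V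
    have h₁ : (E₁.card : ℝ) < 4 * ε * (Fintype.card V : ℝ) ^ 2 :=
      hP.sum_nonUniforms_lt Finset.univ_nonempty hε hPu
    have h₂ : (E₂.card : ℝ) ≤ η / 2 * (Fintype.card V : ℝ) ^ 2 :=
      hP.card_biUnion_offDiag_le hη (hηl.trans (by exact_mod_cast hlP))
    have h₃ : (E₃.card : ℝ) ≤ 4 * d * (Fintype.card V : ℝ) ^ 2 :=
      hP.card_interedges_sparsePairs_le hd
    have hsub : (Finset.univ.filter fun e : V × V => G.Adj e.1 e.2 ∧ ¬ (P.part e.1 ≠ P.part e.2 ∧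
        G.IsUniform ε (P.part e.1) (P.part e.2) ∧ d ≤ G.edgeDensity (P.part e.1) (P.part e.2)))
        ⊆ E₁ ∪ E₂ ∪ E₃ := by
      rintro ⟨u, v⟩ he
      simp only [Finset.mem_filter, Finset.mem_univ, true_and] at he
      obtain ⟨huv, hn⟩ := he
      have hu := P.part_mem.2 (Finset.mem_univ u)
      have hv := P.part_mem.2 (Finset.mem_univ v)
      have hu' := P.mem_part (Finset.mem_univ u)
      have hv' := P.mem_part (Finset.mem_univ v)
      simp only [Finset.mem_union]
      by_cases h1 : P.part u = P.part v
      · refine Or.inl (Or.inr ?_)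
        rw [Finset.mem_biUnion]
        exact ⟨_, hu, Finset.mem_offDiag.2 ⟨hu', h1 ▸ hv', huv.ne⟩⟩
      by_cases h2 : G.IsUniform ε (P.part u) (P.part v)
      · refine Or.inr ?_
        rw [Finset.mem_biUnion]
        refine ⟨(P.part u, P.part v), ?_, ?_⟩
        · rw [Finpartition.mk_mem_sparsePairs]
          exact ⟨hu, hv, h1, not_le.1 fun h3 => hn ⟨h1, h2, h3⟩⟩
        · exact (SimpleGraph.mk_mem_interedges_iff _).2 ⟨hu', hv', huv⟩
      · refine Or.inl (Or.inl ?_)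
        rw [Finset.mem_biUnion]
        refine ⟨(P.part u, P.part v), ?_, ?_⟩
        · rw [Finpartition.mk_mem_nonUniforms]
          exact ⟨hu, hv, h1, h2⟩
        · exact Finset.mk_mem_product hu' hv'
    have h₄ := (Finset.card_le_card hsub).trans ((Finset.card_union_le _ _).trans
      (Nat.add_le_add_right (Finset.card_union_le _ _) _))
    have h₅ : ((Finset.univ.filter fun e : V × V => G.Adj e.1 e.2 ∧ ¬ (P.part e.1 ≠ P.part e.2 ∧
        G.IsUniform ε (P.part e.1) (P.part e.2) ∧
        d ≤ G.edgeDensity (P.part e.1) (P.part e.2))).card : ℝ) ≤ E₁.card + E₂.card + E₃.card := by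
      exact_mod_cast h₄
    simp only [ne_eq, Subtype.mk.injEq]
    simp only [ne_eq] at h₅
    linarith

lemma exists_oscillation_numbers {η : ℝ} (hη0 : 0 < η) (hη1 : η ≤ 1) {ℓ N a q k K : ℕ}
    (hqK : q ≤ K) (hkK : k ≤ (K + 1) ^ 2) (haK : a * K ≤ N)
    (hq : (ℓ : ℝ) + η * N < q * (a + 1)) (hN : (K * (2 * (K + 1) ^ 2 + 7) : ℝ) ≤ η / 2 * N)
    (ha : 4 * (K + 1) ^ 2 + 8 ≤ a) (hℓ : 2 * (K + 1) ^ 2 + 5 ≤ ℓ) (hodd : Odd ℓ) :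
    ∃ T m : ℕ, m ≤ q * T ∧ 2 * k + 5 + 2 * m = ℓ ∧
      (2 * k + 4 + 2 * T : ℝ) ≤ (1 - η / 4) * a := by
  obtain ⟨j, rfl⟩ := hodd
  have hk' : (k : ℝ) ≤ (K + 1) ^ 2 := by exact_mod_cast hkK
  have ha' : 4 * ((K : ℝ) + 1) ^ 2 + 8 ≤ a := by exact_mod_cast ha
  have hqK' : (q : ℝ) ≤ K := by exact_mod_cast hqK
  have haK' : (a : ℝ) * K ≤ N := by exact_mod_cast haK
  have ha0 : (0 : ℝ) ≤ a := Nat.cast_nonneg _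
  have hq0 : (0 : ℝ) ≤ q := Nat.cast_nonneg _
  have hpos : 0 ≤ ((1 - η / 4) * a - 2 * k - 4) / 2 := by nlinarith
  have hT1 := Nat.floor_le hpos
  have hT2 := Nat.lt_floor_add_one (((1 - η / 4) * a - 2 * k - 4) / 2)
  set T := ⌊((1 - η / 4) * a - 2 * k - 4) / 2⌋₊
  refine ⟨T, j - k - 2, ?_, by omega, by linarith⟩
  have h1 : q * (2 * (k : ℝ) + 7) ≤ η / 2 * N := by
    refine le_trans ?_ hN
    gcongr
  have hqa : (q : ℝ) * a ≤ N := by nlinarith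
  have h2 : q * (η / 4 * a) ≤ η / 4 * N := by
    calc q * (η / 4 * a) = η / 4 * (q * a) := by ring
      _ ≤ η / 4 * N := by gcongr
  have h3 : (q : ℝ) * ((1 - η / 4) * a - 2 * k - 6) ≤ q * (2 * T) := by
    gcongr
    linarith
  have h4 : 0 ≤ η * N := by positivity
  have h5 : (j : ℝ) ≤ q * T := by
    push_cast at hq
    linarith
  have h6 : j ≤ q * T := by exact_mod_cast h5
  omega

open scoped Classical in
lemma card_filter_comp_le {V W : Type*} [Fintype V] [Fintype W] (π : V → W) (Q : W → Prop)
    [DecidablePred Q] {b : ℕ}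
    (h : ∀ A, (Finset.univ.filter fun v => π v = A).card ≤ b) :
    (Finset.univ.filter fun v => Q (π v)).card ≤ (Finset.univ.filter Q).card * b := by
  rw [Finset.card_eq_sum_card_fiberwise (f := π) (t := Finset.univ.filter Q)
    (fun v hv => by simpa using hv), ← smul_eq_mul]
  refine Finset.sum_le_card_nsmul _ _ _ fun A _ => (Finset.card_le_card ?_).trans (h A)
  exact Finset.filter_subset_filter _ (Finset.subset_univ _)

open scoped Classical in
lemma mul_le_card_filter_comp {V W : Type*} [Fintype V] [Fintype W] (π : V → W) (Q : W → Prop)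
    [DecidablePred Q] {b : ℕ} (h : ∀ A, b ≤ (Finset.univ.filter fun v => π v = A).card) :
    (Finset.univ.filter Q).card * b ≤ (Finset.univ.filter fun v => Q (π v)).card := by
  rw [Finset.card_eq_sum_card_fiberwise (f := π) (t := Finset.univ.filter Q)
    (fun v hv => by simpa using hv), ← smul_eq_mul]
  refine Finset.card_nsmul_le_sum _ _ _ fun A hA => (h A).trans (Finset.card_le_card ?_)
  intro v
  simp only [Finset.mem_filter, Finset.mem_univ, true_and] at *
  rintro rfl
  exact ⟨hA, rfl⟩

open scoped Classical in
/-- The structure of a large graph without cycles of a given odd length: up to few edges, every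
edge lies in a class, whose parts satisfy size constraints. -/
lemma exists_class_structure {η : ℝ} (hη0 : 0 < η) (hη1 : η ≤ 1) :
    ∃ n₀ : ℕ, ∀ (V : Type) [Fintype V] (G : SimpleGraph V) (ℓ : ℕ), n₀ ≤ Fintype.card V →
      n₀ ≤ ℓ → Odd ℓ → (∀ (v : V) (c : G.Walk v v), c.IsCycle → c.length ≠ ℓ) →
      ∃ (κ : Type) (cls : V → κ) (typ : V → VertexRole),
        ((Finset.univ.filter fun e : V × V => G.Adj e.1 e.2 ∧
          ¬ (cls e.1 = cls e.2 ∧ (typ e.1).Compat (typ e.2))).card : ℝ) ≤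
            η * (Fintype.card V : ℝ) ^ 2 ∧
        (∀ a, ((Finset.univ.filter fun v => cls v = a ∧ typ v = .half).card : ℝ) +
          2 * (Finset.univ.filter fun v => cls v = a ∧ typ v = .inner).card ≤
            ℓ + η * Fintype.card V) ∧
        ((Finset.univ.filter fun v => typ v = .inner).card : ℝ) ≤
          (Finset.univ.filter fun v => typ v = .outer).card + η * Fintype.card V := by
  set d : ℝ := η / 16 with hd
  set ε : ℝ := d * η / 32 with hε
  have hd0 : 0 < d := by positivity
  have hε0 : 0 < ε := by positivity
  set l : ℕ := ⌈8 / η⌉₊ with hl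
  set M : ℕ := SzemerediRegularity.bound ε l with hM
  set L : ℕ := 4 * (M + 1) ^ 2 + 8 + ⌈1 / ε⌉₊ with hL
  set n₀ : ℕ := l + 1 + M * L + 2 * (M + 1) ^ 2 + 5 + ⌈M * (2 * (M + 1) ^ 2 + 7) / (η / 2)⌉₊
    with hn₀
  refine ⟨n₀, fun V _ G ℓ hN hℓ hodd hcyc => ?_⟩
  set N := Fintype.card V with hNdef
  have hNpos : 0 < N := by omega
  have : Nonempty V := Fintype.card_pos_iff.1 hNpos
  obtain ⟨W, _, cl, π, hPM, hmem, hsize, hedges⟩ := G.exists_regular_clusters (η := η / 2) (d := d)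
    (by positivity) hε0 hd0.le (l := l) (by omega) (by
      rw [hl]
      refine le_trans (le_of_eq ?_) (Nat.le_ceil _)
      field_simp
      norm_num)
  set K := Fintype.card W with hK
  set a := N / K with ha
  have hKpos : 0 < K := by
    obtain ⟨v⟩ := this
    exact Fintype.card_pos_iff.2 ⟨π v⟩
  have hfib : ∀ A, (Finset.univ.filter fun v => π v = A) = cl A := fun A => by
    ext v
    simp [hmem]
  have haK : a * K ≤ N := Nat.div_mul_le_self _ _
  have haL : L ≤ a := by
    rw [ha, Nat.le_div_iff_mul_le hKpos]
    calc L * K ≤ L * M := Nat.mul_le_mul_left _ hPM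
      _ = M * L := mul_comm _ _
      _ ≤ N := by omega
  have hN7 : (M * (2 * (M + 1) ^ 2 + 7) : ℝ) ≤ η / 2 * N := by
    have h1 : (⌈M * (2 * (M + 1) ^ 2 + 7) / (η / 2)⌉₊ : ℝ) ≤ N := by
      exact_mod_cast (by omega : ⌈(M * (2 * (M + 1) ^ 2 + 7) : ℝ) / (η / 2)⌉₊ ≤ N)
    have h2 := (Nat.le_ceil _).trans h1
    rw [div_le_iff₀ (by positivity)] at h2
    linarith
  have hKM : (K : ℝ) ≤ M := by exact_mod_cast hPM
  have hN7' : (K * (2 * (K + 1) ^ 2 + 7) : ℝ) ≤ η / 2 * N := by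
    refine le_trans ?_ hN7
    gcongr
  have hKM2 : (K + 1) ^ 2 ≤ (M + 1) ^ 2 := Nat.pow_le_pow_left (by omega) 2
  have hεa : 1 ≤ ε * a := by
    have h1 : (⌈1 / ε⌉₊ : ℝ) ≤ a := by exact_mod_cast (by omega : ⌈1 / ε⌉₊ ≤ a)
    have h2 := (Nat.le_ceil _).trans h1
    rw [div_le_iff₀ hε0] at h2
    linarith
  let Γ : SimpleGraph W :=
    { Adj := fun A B => A ≠ B ∧ G.IsUniform ε (cl A) (cl B) ∧ d ≤ G.edgeDensity (cl A) (cl B)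
      symm := ⟨fun A B h => ⟨h.1.symm, h.2.1.symm, by
        rw [SimpleGraph.edgeDensity_comm]
        exact h.2.2⟩⟩
      loopless := ⟨fun A h => h.1 rfl⟩ }
  obtain ⟨typ, hcompat, hio, hcomp⟩ := exists_vertexRole Γ
  have hlo : ∀ A, a ≤ (Finset.univ.filter fun v => π v = A).card := fun A => by
    rw [hfib]
    exact (hsize A).1
  have hup : ∀ A, (Finset.univ.filter fun v => π v = A).card ≤ a + 1 := fun A => by
    rw [hfib]
    exact (hsize A).2
  refine ⟨Γ.ConnectedComponent, fun v => Γ.connectedComponentMk (π v), fun v => typ (π v),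
    ?_, ?_, ?_⟩
  · refine le_trans (Nat.cast_le.2 (Finset.card_le_card ?_)) (hedges.trans ?_)
    · intro e
      simp only [Finset.mem_filter, Finset.mem_univ, true_and]
      rintro ⟨h1, h2⟩
      refine ⟨h1, fun h3 => h2 ?_⟩
      have h4 : Γ.Adj (π e.1) (π e.2) := h3
      exact ⟨SimpleGraph.ConnectedComponent.sound h4.reachable, hcompat _ _ h4⟩
    · gcongr
      have : ε ≤ η / 32 := by rw [hε, hd]; nlinarith
      linarith
  · intro c
    rcases hcomp c with hc | ⟨q, k, hqK, hhalf, hk, hwalk⟩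
    · rw [Finset.filter_false_of_mem, Finset.filter_false_of_mem]
      · simp only [Finset.card_empty, Nat.cast_zero, mul_zero, add_zero]
        positivity
      · exact fun v _ h => (hc _ h.1).2 h.2
      · exact fun v _ h => (hc _ h.1).1 h.2
    · by_contra! hlt
      have h1 := card_filter_comp_le π (fun A => Γ.connectedComponentMk A = c ∧ typ A = .half) hup
      have h2 := card_filter_comp_le π (fun A => Γ.connectedComponentMk A = c ∧ typ A = .inner) hup
      have h3 := Nat.mul_le_mul_right (a + 1) hhalf
      have h4 : (ℓ : ℝ) + η * N < q * (a + 1) := by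
        refine hlt.trans_le ?_
        norm_cast
        rw [add_mul] at h3
        refine le_trans ?_ h3
        rw [mul_assoc]
        exact Nat.add_le_add h1 (Nat.mul_le_mul_left _ h2)
      change q ≤ K at hqK
      change k ≤ (K + 1) ^ 2 at hk
      obtain ⟨T, m, hm, hlen, hT⟩ := exists_oscillation_numbers hη0 hη1 hqK hk haK h4 hN7'
        (by omega) (by omega) hodd
      obtain ⟨r, r', hr, w, hw, hcount⟩ := hwalk T m hm
      obtain ⟨v, cyc, hcy, hcl⟩ := exists_isCycle_of_closed_walk (G := G) (Γ := Γ)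
        (cl := cl) (ε := ε) (d := d) (β := η / 4) hε0 (by rw [hε, hd]; nlinarith)
        (by linarith) (by linarith) (by positivity)
        (fun A B v hA hB => ((hmem A v).1 hA).symm.trans ((hmem B v).1 hB))
        (fun A => hεa.trans (by gcongr; exact (hsize A).1))
        (fun A B h => h.2) hr w (fun C => by
          have h5 : (w.support.count C : ℝ) ≤ 2 * k + 2 + 2 * T := by exact_mod_cast hcount C
          have h6 : (a : ℝ) ≤ (cl C).card := by exact_mod_cast (hsize C).1
          have h7 : (1 - η / 4) * a ≤ (1 - η / 4) * (cl C).card := by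
            gcongr
            linarith
          linarith)
      exact hcyc v cyc hcy (by omega)
  · have h1 := card_filter_comp_le π (fun A => typ A = .inner) hup
    have h2 := mul_le_card_filter_comp π (fun A => typ A = .outer) hlo
    have h3 : (Finset.univ.filter fun A => typ A = .outer).card ≤ K := by
      exact Finset.card_le_univ _
    have h4 := Nat.mul_le_mul_right (a + 1) hio
    have h5 : (Finset.univ.filter fun v => typ (π v) = .inner).card ≤
        (Finset.univ.filter fun v => typ (π v) = .outer).card + K := by
      rw [mul_add, mul_one] at h4
      rw [mul_add, mul_one] at h1
      rw [mul_add, mul_one] at h4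
      omega
    have h6 : (K : ℝ) ≤ η * N := by
      have : 0 ≤ η * N := by positivity
      have : (0 : ℝ) ≤ K := Nat.cast_nonneg _
      nlinarith
    have h7 : ((Finset.univ.filter fun v => typ (π v) = .inner).card : ℝ) ≤
        (Finset.univ.filter fun v => typ (π v) = .outer).card + K := by
      exact_mod_cast h5
    linarith

section Weights

/-- The weight of a role, depending on which side of the bipartite components and which part of the
non-bipartite components is kept. -/
noncomputable def VertexRole.weight (σ β : Bool) : VertexRole → ℝ
  | left => if β then 1 else 0
  | right => if β then 0 else 1
  | outer => if σ then 1 else 0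
  | half => 1 / 2
  | inner => if σ then 0 else 1

lemma VertexRole.weight_mem (σ β : Bool) (t : VertexRole) :
    0 ≤ t.weight σ β ∧ t.weight σ β ≤ 1 := by
  cases t <;> cases σ <;> cases β <;> norm_num [VertexRole.weight]

lemma VertexRole.sum_weight (t : VertexRole) :
    t.weight true true + t.weight true false + t.weight false true + t.weight false false = 2 := by
  cases t <;> norm_num [VertexRole.weight]

/-- The label of a vertex: its class, if it is in the half or inner part of that class. -/
def classLabel {V κ : Type*} (cls : V → κ) (typ : V → VertexRole) (v : V) : Option κ :=
  match typ v with
  | .half => some (cls v)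
  | .inner => some (cls v)
  | _ => none

variable {V κ : Type*} {cls : V → κ} {typ : V → VertexRole}

lemma sameLabel_of_compat {σ β : Bool} {u v : V} (hcls : cls u = cls v)
    (h : (typ u).Compat (typ v)) (hu : (typ u).weight σ β ≠ 0) (hv : (typ v).weight σ β ≠ 0) :
    SameLabel (classLabel cls typ) u v := by
  unfold SameLabel classLabel
  revert h hu hv
  cases typ u <;> cases typ v <;> cases σ <;> cases β <;>
    simp [VertexRole.weight, VertexRole.Compat, hcls]

lemma weight_le_half {β : Bool} {v : V} (h : classLabel cls typ v ≠ none) :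
    (typ v).weight true β ≤ 1 / 2 := by
  unfold classLabel at h
  revert h
  cases typ v <;> norm_num [VertexRole.weight]

open scoped Classical in
lemma sum_weight_le [Fintype V] {M : ℝ} (X : Finset V) (σ β : Bool)
    (h : ∀ a, ((Finset.univ.filter fun v => cls v = a ∧ typ v = .half).card : ℝ) +
      2 * (Finset.univ.filter fun v => cls v = a ∧ typ v = .inner).card ≤ 2 * M)
    (a : Option κ) (ha : a ≠ none) :
    ∑ v ∈ X with classLabel cls typ v = a, (typ v).weight σ β ≤ M := by
  obtain ⟨c, rfl⟩ := Option.ne_none_iff_exists'.1 ha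
  have h1 : ∀ v ∈ X.filter (fun v => classLabel cls typ v = some c), (typ v).weight σ β ≤
      (if cls v = c ∧ typ v = .half then 1 / 2 else 0) +
      if cls v = c ∧ typ v = .inner then 1 else 0 := by
    intro v hv
    have := (Finset.mem_filter.1 hv).2
    unfold classLabel at this
    revert this
    cases typ v <;> cases σ <;> simp +contextual [VertexRole.weight]
  have h2 : ∀ v : V, (0 : ℝ) ≤ (if cls v = c ∧ typ v = .half then 1 / 2 else 0) +
      if cls v = c ∧ typ v = .inner then 1 else 0 := fun v => by
    split_ifs <;> norm_num
  refine (Finset.sum_le_sum h1).trans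
    ((Finset.sum_le_sum_of_subset_of_nonneg (Finset.subset_univ _) fun v _ _ => h2 v).trans ?_)
  rw [Finset.sum_add_distrib, ← Finset.sum_filter, ← Finset.sum_filter, Finset.sum_const,
    Finset.sum_const, nsmul_eq_mul, nsmul_eq_mul]
  have := h c
  linarith

end Weights

open scoped Classical in
/-- The bound for one choice of the kept sides and parts. -/
lemma sum_weight_mul_le {V κ₁ κ₂ κ₃ : Type*} [Fintype V] {cls₁ : V → κ₁} {cls₂ : V → κ₂}
    {cls₃ : V → κ₃} {typ₁ typ₂ typ₃ : V → VertexRole} {M : ℝ} {D : ℕ} (hM : 0 ≤ M)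
    (h₁ : ∀ a, ((Finset.univ.filter fun v => cls₁ v = a ∧ typ₁ v = .half).card : ℝ) +
      2 * (Finset.univ.filter fun v => cls₁ v = a ∧ typ₁ v = .inner).card ≤ 2 * M)
    (h₂ : ∀ a, ((Finset.univ.filter fun v => cls₂ v = a ∧ typ₂ v = .half).card : ℝ) +
      2 * (Finset.univ.filter fun v => cls₂ v = a ∧ typ₂ v = .inner).card ≤ 2 * M)
    (h₃ : ∀ a, ((Finset.univ.filter fun v => cls₃ v = a ∧ typ₃ v = .half).card : ℝ) +
      2 * (Finset.univ.filter fun v => cls₃ v = a ∧ typ₃ v = .inner).card ≤ 2 * M)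
    {V' : Finset V} (hV' : ∀ v ∈ V', (Finset.univ.filter fun u =>
      ¬ ((cls₁ v = cls₁ u ∧ (typ₁ v).Compat (typ₁ u)) ∨
        (cls₂ v = cls₂ u ∧ (typ₂ v).Compat (typ₂ u)) ∨
        (cls₃ v = cls₃ u ∧ (typ₃ v).Compat (typ₃ u)))).card ≤ D) (σ₁ β₁ σ₂ β₂ β₃ : Bool) :
    ∑ v ∈ V', (typ₁ v).weight σ₁ β₁ * (typ₂ v).weight σ₂ β₂ * (typ₃ v).weight true β₃ ≤
      M + 4 * D := by
  set X := V'.filter fun v => (typ₁ v).weight σ₁ β₁ * (typ₂ v).weight σ₂ β₂ *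
    (typ₃ v).weight true β₃ ≠ 0 with hX
  have hX' : ∀ v ∈ X, v ∈ V' ∧ (typ₁ v).weight σ₁ β₁ ≠ 0 ∧ (typ₂ v).weight σ₂ β₂ ≠ 0 ∧
      (typ₃ v).weight true β₃ ≠ 0 := by
    intro v hv
    rw [hX, Finset.mem_filter, mul_ne_zero_iff, mul_ne_zero_iff, and_assoc] at hv
    exact hv
  rw [← Finset.sum_filter_ne_zero]
  refine sum_mul_le_of_sameLabel (g₁ := classLabel cls₁ typ₁) (g₂ := classLabel cls₂ typ₂)
    (g₃ := classLabel cls₃ typ₃) hM (fun v _ => VertexRole.weight_mem _ _ _)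
    (fun v _ => VertexRole.weight_mem _ _ _) (fun v _ => VertexRole.weight_mem _ _ _)
    (fun v _ hv => weight_le_half hv) (sum_weight_le X _ _ h₁) (sum_weight_le X _ _ h₂)
    (sum_weight_le X _ _ h₃) fun v hv => ?_
  refine (Finset.card_le_card fun u hu => ?_).trans (hV' v (hX' v hv).1)
  rw [Finset.mem_filter] at hu ⊢
  refine ⟨Finset.mem_univ _, fun h => hu.2 ?_⟩
  have hv := hX' v hv
  have hu := hX' u hu.1
  rcases h with h | h | h
  · exact Or.inl (sameLabel_of_compat h.1 h.2 hv.2.1 hu.2.1)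
  · exact Or.inr (Or.inl (sameLabel_of_compat h.1 h.2 hv.2.2.1 hu.2.2.1))
  · exact Or.inr (Or.inr (sameLabel_of_compat h.1 h.2 hv.2.2.2 hu.2.2.2))

open scoped Classical in
/-- Averaging over all choices of the kept sides and parts. -/
lemma four_mul_card_le {V κ₁ κ₂ κ₃ : Type*} [Fintype V] {cls₁ : V → κ₁} {cls₂ : V → κ₂}
    {cls₃ : V → κ₃} {typ₁ typ₂ typ₃ : V → VertexRole} {M : ℝ} {D : ℕ} (hM : 0 ≤ M)
    (h₁ : ∀ a, ((Finset.univ.filter fun v => cls₁ v = a ∧ typ₁ v = .half).card : ℝ) +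
      2 * (Finset.univ.filter fun v => cls₁ v = a ∧ typ₁ v = .inner).card ≤ 2 * M)
    (h₂ : ∀ a, ((Finset.univ.filter fun v => cls₂ v = a ∧ typ₂ v = .half).card : ℝ) +
      2 * (Finset.univ.filter fun v => cls₂ v = a ∧ typ₂ v = .inner).card ≤ 2 * M)
    (h₃ : ∀ a, ((Finset.univ.filter fun v => cls₃ v = a ∧ typ₃ v = .half).card : ℝ) +
      2 * (Finset.univ.filter fun v => cls₃ v = a ∧ typ₃ v = .inner).card ≤ 2 * M)
    {V' : Finset V} (hV' : ∀ v ∈ V', (Finset.univ.filter fun u =>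
      ¬ ((cls₁ v = cls₁ u ∧ (typ₁ v).Compat (typ₁ u)) ∨
        (cls₂ v = cls₂ u ∧ (typ₂ v).Compat (typ₂ u)) ∨
        (cls₃ v = cls₃ u ∧ (typ₃ v).Compat (typ₃ u)))).card ≤ D) :
    4 * ((V'.card : ℝ) + (V'.filter fun v => typ₃ v = .outer).card -
      (V'.filter fun v => typ₃ v = .inner).card) ≤ 32 * (M + 4 * D) := by
  have h := Finset.sum_le_card_nsmul (Finset.univ : Finset (Bool × Bool × Bool × Bool × Bool))
    _ _ fun p _ => sum_weight_mul_le hM h₁ h₂ h₃ hV' p.1 p.2.1 p.2.2.1 p.2.2.2.1 p.2.2.2.2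
  rw [Finset.sum_comm, Finset.card_univ] at h
  have hcard : Fintype.card (Bool × Bool × Bool × Bool × Bool) = 32 := by
    simp [Fintype.card_prod]
  have hterm : ∀ v ∈ V', (∑ p : Bool × Bool × Bool × Bool × Bool, (typ₁ v).weight p.1 p.2.1 *
      (typ₂ v).weight p.2.2.1 p.2.2.2.1 * (typ₃ v).weight true p.2.2.2.2) =
      4 * (1 + (if typ₃ v = .outer then 1 else 0) - if typ₃ v = .inner then 1 else 0) := by
    intro v _
    have e₁ := (typ₁ v).sum_weight
    have e₂ := (typ₂ v).sum_weight
    have e₃ : (typ₃ v).weight true true + (typ₃ v).weight true false =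
        1 + (if typ₃ v = .outer then 1 else 0) - if typ₃ v = .inner then 1 else 0 := by
      cases typ₃ v <;> (simp [VertexRole.weight]; try norm_num)
    simp only [Fintype.sum_prod_type, Fintype.sum_bool]
    rw [← e₃, (by norm_num : (4 : ℝ) = 2 * 2)]
    nth_rewrite 1 [← e₁]
    rw [← e₂]
    ring
  rw [Finset.sum_congr rfl hterm, hcard, ← Finset.mul_sum, Finset.sum_sub_distrib,
    Finset.sum_add_distrib, Finset.sum_boole, Finset.sum_boole, nsmul_eq_mul] at h
  simpa using h

open scoped Classical in
/-- If few pairs are not related, then most elements are related to almost all elements. -/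
lemma card_filter_ge_of_few_unrelated {V : Type*} [Fintype V] {r : V → V → Prop}
    [DecidableRel r] {γ : ℝ} (hγ : 0 < γ)
    (h : ((Finset.univ.filter fun e : V × V => ¬ r e.1 e.2).card : ℝ) ≤
      4 * γ ^ 2 * (Fintype.card V : ℝ) ^ 2) :
    (Fintype.card V : ℝ) - 2 * γ * Fintype.card V ≤
      (Finset.univ.filter fun v => (Finset.univ.filter fun u => ¬ r v u).card ≤
        ⌊2 * γ * Fintype.card V⌋₊).card := by
  set N : ℝ := (Fintype.card V : ℝ) with hN
  set W := Finset.univ.filter fun v : V => ¬ (Finset.univ.filter fun u => ¬ r v u).card ≤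
    ⌊2 * γ * N⌋₊ with hW
  have hsplit := Finset.card_filter_add_card_filter_not (s := (Finset.univ : Finset V))
    fun v => (Finset.univ.filter fun u => ¬ r v u).card ≤ ⌊2 * γ * N⌋₊
  rw [← hW, Finset.card_univ] at hsplit
  have hsplit' := congrArg (Nat.cast (R := ℝ)) hsplit
  push_cast at hsplit'
  rw [← hN] at hsplit'
  have hpairs : ((Finset.univ.filter fun e : V × V => ¬ r e.1 e.2).card : ℝ) =
      ∑ v : V, ((Finset.univ.filter fun u => ¬ r v u).card : ℝ) := by
    simp only [Finset.card_filter, Fintype.sum_prod_type, Nat.cast_sum]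
  have hlow : W.card * (2 * γ * N) ≤ ∑ v : V, ((Finset.univ.filter fun u => ¬ r v u).card : ℝ) := by
    rw [← nsmul_eq_mul]
    refine (Finset.card_nsmul_le_sum W _ _ fun v hv => ?_).trans
      (Finset.sum_le_sum_of_subset_of_nonneg (Finset.subset_univ _) fun v _ _ => Nat.cast_nonneg _)
    exact (Nat.lt_of_floor_lt (not_le.1 (Finset.mem_filter.1 hv).2)).le
  have hWle : (W.card : ℝ) ≤ 2 * γ * N := by
    rcases (Nat.cast_nonneg (Fintype.card V) : (0 : ℝ) ≤ Fintype.card V).eq_or_lt with h0 | h0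
    · have hN0 : N = 0 := h0.symm
      have hWN : (W.card : ℝ) ≤ N := Nat.cast_le.2 (Finset.card_le_univ W)
      rw [hN0] at hWN ⊢
      linarith
    · have hpos : 0 < 2 * γ * N := by positivity
      refine le_of_mul_le_mul_right ?_ hpos
      calc _ ≤ _ := hlow
        _ ≤ 4 * γ ^ 2 * N ^ 2 := hpairs ▸ h
        _ = _ := by ring
  linarith

open scoped Classical in
lemma card_unrelated_le {V : Type*} [Fintype V] {G₁ G₂ G₃ : SimpleGraph V}
    (hG : ∀ u v, u ≠ v → G₁.Adj u v ∨ G₂.Adj u v ∨ G₃.Adj u v) {r₁ r₂ r₃ : V → V → Prop}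
    [DecidableRel r₁] [DecidableRel r₂] [DecidableRel r₃] {b : ℝ}
    (h₁ : ((Finset.univ.filter fun e : V × V => G₁.Adj e.1 e.2 ∧ ¬ r₁ e.1 e.2).card : ℝ) ≤ b)
    (h₂ : ((Finset.univ.filter fun e : V × V => G₂.Adj e.1 e.2 ∧ ¬ r₂ e.1 e.2).card : ℝ) ≤ b)
    (h₃ : ((Finset.univ.filter fun e : V × V => G₃.Adj e.1 e.2 ∧ ¬ r₃ e.1 e.2).card : ℝ) ≤ b) :
    ((Finset.univ.filter fun e : V × V => ¬ (r₁ e.1 e.2 ∨ r₂ e.1 e.2 ∨ r₃ e.1 e.2)).card : ℝ) ≤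
      3 * b + Fintype.card V := by
  have hsub : (Finset.univ.filter fun e : V × V => ¬ (r₁ e.1 e.2 ∨ r₂ e.1 e.2 ∨ r₃ e.1 e.2)) ⊆
      ((Finset.univ.filter fun e : V × V => G₁.Adj e.1 e.2 ∧ ¬ r₁ e.1 e.2) ∪
        (Finset.univ.filter fun e : V × V => G₂.Adj e.1 e.2 ∧ ¬ r₂ e.1 e.2)) ∪
      ((Finset.univ.filter fun e : V × V => G₃.Adj e.1 e.2 ∧ ¬ r₃ e.1 e.2) ∪
        Finset.univ.image fun v : V => (v, v)) := by
    rintro ⟨u, v⟩ huv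
    simp only [Finset.mem_filter, Finset.mem_univ, true_and, not_or, Finset.mem_union,
      Finset.mem_image, Prod.mk.injEq] at huv ⊢
    by_cases h : u = v
    · exact Or.inr (Or.inr ⟨u, rfl, h⟩)
    · have := hG u v h
      tauto
  have hcard := (Finset.card_le_card hsub).trans ((Finset.card_union_le _ _).trans
    (add_le_add (Finset.card_union_le _ _) (Finset.card_union_le _ _)))
  have himage : (Finset.univ.image fun v : V => (v, v)).card ≤ Fintype.card V :=
    Finset.card_image_le.trans_eq Finset.card_univ
  have hcard' : ((Finset.univ.filter fun e : V × V =>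
      ¬ (r₁ e.1 e.2 ∨ r₂ e.1 e.2 ∨ r₃ e.1 e.2)).card : ℝ) ≤ _ := Nat.cast_le.2 hcard
  have himage' : ((Finset.univ.image fun v : V => (v, v)).card : ℝ) ≤ Fintype.card V :=
    Nat.cast_le.2 himage
  push_cast at hcard'
  linarith

open scoped Classical in
/-- The bound on the number of vertices in terms of the three class structures. -/
lemma card_mul_le_of_few_unrelated {V κ₁ κ₂ κ₃ : Type*} [Fintype V] {cls₁ : V → κ₁}
    {cls₂ : V → κ₂} {cls₃ : V → κ₃} {typ₁ typ₂ typ₃ : V → VertexRole} {M γ b : ℝ} (hM : 0 ≤ M)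
    (hγ : 0 < γ)
    (h₁ : ∀ a, ((Finset.univ.filter fun v => cls₁ v = a ∧ typ₁ v = .half).card : ℝ) +
      2 * (Finset.univ.filter fun v => cls₁ v = a ∧ typ₁ v = .inner).card ≤ 2 * M)
    (h₂ : ∀ a, ((Finset.univ.filter fun v => cls₂ v = a ∧ typ₂ v = .half).card : ℝ) +
      2 * (Finset.univ.filter fun v => cls₂ v = a ∧ typ₂ v = .inner).card ≤ 2 * M)
    (h₃ : ∀ a, ((Finset.univ.filter fun v => cls₃ v = a ∧ typ₃ v = .half).card : ℝ) +
      2 * (Finset.univ.filter fun v => cls₃ v = a ∧ typ₃ v = .inner).card ≤ 2 * M)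
    (ho : ((Finset.univ.filter fun v => typ₃ v = .inner).card : ℝ) ≤
      (Finset.univ.filter fun v => typ₃ v = .outer).card + b)
    (hun : ((Finset.univ.filter fun e : V × V =>
      ¬ ((cls₁ e.1 = cls₁ e.2 ∧ (typ₁ e.1).Compat (typ₁ e.2)) ∨
        (cls₂ e.1 = cls₂ e.2 ∧ (typ₂ e.1).Compat (typ₂ e.2)) ∨
        (cls₃ e.1 = cls₃ e.2 ∧ (typ₃ e.1).Compat (typ₃ e.2)))).card : ℝ) ≤
      4 * γ ^ 2 * (Fintype.card V : ℝ) ^ 2) :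
    (Fintype.card V : ℝ) * (1 - 68 * γ) ≤ 8 * M + b := by
  obtain ⟨V', hlarge, hV'⟩ : ∃ V' : Finset V,
      (Fintype.card V : ℝ) - 2 * γ * Fintype.card V ≤ V'.card ∧
      ∀ v ∈ V', (Finset.univ.filter fun u =>
        ¬ ((cls₁ v = cls₁ u ∧ (typ₁ v).Compat (typ₁ u)) ∨
          (cls₂ v = cls₂ u ∧ (typ₂ v).Compat (typ₂ u)) ∨
          (cls₃ v = cls₃ u ∧ (typ₃ v).Compat (typ₃ u)))).card ≤ ⌊2 * γ * Fintype.card V⌋₊ :=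
    ⟨_, card_filter_ge_of_few_unrelated (r := fun v u =>
      (cls₁ v = cls₁ u ∧ (typ₁ v).Compat (typ₁ u)) ∨
        (cls₂ v = cls₂ u ∧ (typ₂ v).Compat (typ₂ u)) ∨
        (cls₃ v = cls₃ u ∧ (typ₃ v).Compat (typ₃ u))) hγ hun,
      fun v hv => (Finset.mem_filter.1 hv).2⟩
  have hmain := four_mul_card_le hM h₁ h₂ h₃ hV'
  have hD := Nat.floor_le (by positivity : 0 ≤ 2 * γ * (Fintype.card V : ℝ))
  have hinner : ((V'.filter fun v => typ₃ v = .inner).card : ℝ) ≤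
      (Finset.univ.filter fun v => typ₃ v = .inner).card :=
    Nat.cast_le.2 (Finset.card_le_card (Finset.filter_subset_filter _ (Finset.subset_univ _)))
  have houter : ((Finset.univ.filter fun v => typ₃ v = .outer).card : ℝ) + V'.card ≤
      (V'.filter fun v => typ₃ v = .outer).card + Fintype.card V := by
    have h := Finset.card_union_add_card_inter (Finset.univ.filter fun v => typ₃ v = .outer) V'
    have h' : (Finset.univ.filter fun v => typ₃ v = .outer) ∩ V' =
        V'.filter fun v => typ₃ v = .outer := by
      rw [Finset.inter_comm, Finset.inter_filter, Finset.inter_univ]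
    have h'' := Finset.card_le_univ ((Finset.univ.filter fun v => typ₃ v = .outer) ∪ V')
    rw [h'] at h
    have h₀ : (Finset.univ.filter fun v => typ₃ v = .outer).card + V'.card ≤
        (V'.filter fun v => typ₃ v = .outer).card + Fintype.card V := by omega
    exact_mod_cast h₀
  linarith

lemma false_of_card_bound {γ n N : ℝ} (hγ0 : 0 < γ) (hγ1 : γ ≤ 1 / 2000) (hn : 1 < γ * n)
    (hN : (8 + 2000 * γ) * n - 1 ≤ N) (hN0 : 0 ≤ N)
    (h : N * (1 - 68 * γ) ≤ 8 * ((2 * n + 1 + γ ^ 2 * N) / 2) + γ ^ 2 * N) : False := by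
  have hcoef : 1 - 70 * γ ≤ 1 - 68 * γ - 5 * γ ^ 2 := by nlinarith
  have hfin : ((8 + 2000 * γ) * n - 1) * (1 - 70 * γ) ≤ 8 * n + 4 :=
    (mul_le_mul hN hcoef (by linarith) hN0).trans (by linarith)
  nlinarith [mul_le_mul_of_nonneg_right hγ1 (by linarith : 0 ≤ γ * n)]

open scoped Classical in
lemma exists_isCycle_of_three_cover {δ : ℝ} (hδ0 : 0 < δ) (hδ1 : δ ≤ 1) :
    ∃ n₀ : ℕ, ∀ (V : Type) [Fintype V] (G₁ G₂ G₃ : SimpleGraph V) (n₁ n₂ n₃ : ℕ),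
      n₂ ≤ n₁ → n₃ ≤ n₂ → n₀ ≤ n₃ → (8 + δ) * n₁ - 1 ≤ Fintype.card V →
      (∀ u v, u ≠ v → G₁.Adj u v ∨ G₂.Adj u v ∨ G₃.Adj u v) →
      (∀ (v : V) (w : G₁.Walk v v), w.IsCycle → w.length ≠ 2 * n₁ + 1) →
      (∀ (v : V) (w : G₂.Walk v v), w.IsCycle → w.length ≠ 2 * n₂ + 1) →
      (∀ (v : V) (w : G₃.Walk v v), w.IsCycle → w.length ≠ 2 * n₃ + 1) → False := by
  obtain ⟨γ, rfl⟩ : ∃ γ, δ = 2000 * γ := ⟨δ / 2000, by ring⟩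
  have hγ0 : 0 < γ := by linarith
  have hγ1 : γ ≤ 1 / 2000 := by linarith
  obtain ⟨m, hm⟩ := exists_class_structure (η := γ ^ 2) (by positivity) (by nlinarith)
  obtain ⟨m', hm'⟩ := exists_nat_gt (1 / γ ^ 2)
  refine ⟨m + m' + 1, fun V _ G₁ G₂ G₃ n₁ n₂ n₃ h₂₁ h₃₂ h₀ hV hG hc₁ hc₂ hc₃ => ?_⟩
  have hr₁ : (m : ℝ) + m' + 1 ≤ n₁ := by exact_mod_cast h₀.trans (h₃₂.trans h₂₁)
  have hr₂ : (n₂ : ℝ) ≤ n₁ := by exact_mod_cast h₂₁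
  have hr₃ : (n₃ : ℝ) ≤ n₂ := by exact_mod_cast h₃₂
  have hmnn : (0 : ℝ) ≤ m := Nat.cast_nonneg m
  have hmnn' : (0 : ℝ) ≤ m' := Nat.cast_nonneg m'
  have hγn : 0 ≤ γ * n₁ := by positivity
  have hVn : (n₁ : ℝ) ≤ Fintype.card V := by nlinarith
  have hmV : m ≤ Fintype.card V := by
    have : (m : ℝ) ≤ Fintype.card V := by linarith
    exact_mod_cast this
  obtain ⟨κ₁, cls₁, typ₁, hb₁, hs₁, -⟩ := hm V G₁ (2 * n₁ + 1) hmV (by omega) ⟨n₁, rfl⟩ hc₁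
  obtain ⟨κ₂, cls₂, typ₂, hb₂, hs₂, -⟩ := hm V G₂ (2 * n₂ + 1) hmV (by omega) ⟨n₂, rfl⟩ hc₂
  obtain ⟨κ₃, cls₃, typ₃, hb₃, hs₃, ho₃⟩ := hm V G₃ (2 * n₃ + 1) hmV (by omega) ⟨n₃, rfl⟩ hc₃
  have hun := card_unrelated_le hG
    (r₁ := fun u v => cls₁ u = cls₁ v ∧ (typ₁ u).Compat (typ₁ v))
    (r₂ := fun u v => cls₂ u = cls₂ v ∧ (typ₂ u).Compat (typ₂ v))
    (r₃ := fun u v => cls₃ u = cls₃ v ∧ (typ₃ u).Compat (typ₃ v)) hb₁ hb₂ hb₃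
  have hN0 : (0 : ℝ) < Fintype.card V := by linarith
  have hNγ : 1 ≤ γ ^ 2 * (Fintype.card V : ℝ) := by
    have : 1 / γ ^ 2 < (Fintype.card V : ℝ) := by linarith
    rw [div_lt_iff₀ (by positivity)] at this
    linarith
  have hn : 1 < γ * n₁ := by
    have : 1 / γ ^ 2 < n₁ := by linarith
    rw [div_lt_iff₀ (by positivity)] at this
    nlinarith
  have hbound := card_mul_le_of_few_unrelated
    (M := (2 * n₁ + 1 + γ ^ 2 * (Fintype.card V : ℝ)) / 2) (by positivity) hγ0
    (fun a => (hs₁ a).trans (by push_cast; linarith))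
    (fun a => (hs₂ a).trans (by push_cast; linarith))
    (fun a => (hs₃ a).trans (by push_cast; linarith)) ho₃
    (hun.trans (by nlinarith [mul_le_mul_of_nonneg_right hNγ hN0.le]))
  exact false_of_card_bound hγ0 hγ1 hn hV hN0.le hbound

/-- The graph formed by the edges of one color. -/
def colorGraph {V : Type*} {k : ℕ} (c : (⊤ : SimpleGraph V).edgeSet → Fin k) (i : Fin k) :
    SimpleGraph V :=
  SimpleGraph.fromEdgeSet {e | ∃ h : e ∈ (⊤ : SimpleGraph V).edgeSet, c ⟨e, h⟩ = i}

lemma hasMonoCycle_of_isCycle {V : Type*} {k : ℕ} {c : (⊤ : SimpleGraph V).edgeSet → Fin k}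
    {i : Fin k} {v : V} {w : (colorGraph c i).Walk v v} (hw : w.IsCycle) :
    HasMonoCycle ⊤ c i w.length := by
  refine ⟨v, w.mapLe le_top, hw.mapLe le_top, by simp, fun e he => ?_⟩
  rw [SimpleGraph.Walk.edges_mapLe_eq_edges] at he
  have := w.edges_subset_edgeSet he
  rw [colorGraph, SimpleGraph.edgeSet_fromEdgeSet] at this
  exact this.1.2

lemma colorGraph_adj_of_eq {V : Type*} {k : ℕ} {c : (⊤ : SimpleGraph V).edgeSet → Fin k}
    {i : Fin k} {u v : V} (huv : u ≠ v)
    (h : c ⟨s(u, v), by simpa using huv⟩ = i) : (colorGraph c i).Adj u v := by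
  rw [colorGraph, SimpleGraph.fromEdgeSet_adj]
  exact ⟨⟨_, h⟩, huv⟩

lemma exists_arrowsCycles_of_le {δ : ℝ} (hδ0 : 0 < δ) (hδ1 : δ ≤ 1) :
    ∃ n₀ : ℕ, ∀ n₁ n₂ n₃ N : ℕ, n₂ ≤ n₁ → n₃ ≤ n₂ → n₀ ≤ n₃ → (8 + δ) * n₁ - 1 ≤ N →
      ArrowsCycles (⊤ : SimpleGraph (Fin N)) ![2 * n₁ + 1, 2 * n₂ + 1, 2 * n₃ + 1] := by
  obtain ⟨n₀, h⟩ := exists_isCycle_of_three_cover hδ0 hδ1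
  refine ⟨n₀, fun n₁ n₂ n₃ N h₂₁ h₃₂ h₀ hN c => ?_⟩
  by_contra! hc
  refine h (Fin N) (colorGraph c 0) (colorGraph c 1) (colorGraph c 2) n₁ n₂ n₃ h₂₁ h₃₂ h₀
    (by simpa using hN) (fun u v huv => ?_) (fun v w hw hl => hc 0 ?_) (fun v w hw hl => hc 1 ?_)
    fun v w hw hl => hc 2 ?_
  · have key : ∀ i : Fin 3, i = 0 ∨ i = 1 ∨ i = 2 := by decide
    exact (key (c ⟨s(u, v), by simpa using huv⟩)).imp (colorGraph_adj_of_eq huv)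
      (Or.imp (colorGraph_adj_of_eq huv) (colorGraph_adj_of_eq huv))
  all_goals
    have := hasMonoCycle_of_isCycle hw
    rw [hl] at this
    exact this

theorem stmt2 (δ : ℝ) (hδ : 0 < δ) :
    ∃ n₀ : ℕ, ∀ n₁ n₂ n₃ : ℕ, n₂ ≤ n₁ → n₃ ≤ n₂ → n₀ < n₃ →
      8 * n₁ < ramseyCycles ![2 * n₁ + 1, 2 * n₂ + 1, 2 * n₃ + 1] ∧
      (ramseyCycles ![2 * n₁ + 1, 2 * n₂ + 1, 2 * n₃ + 1] : ℝ) ≤ (8 + δ) * n₁ := by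
  obtain ⟨n₀, h⟩ := exists_arrowsCycles_of_le (lt_min hδ one_pos) (min_le_right δ 1)
  refine ⟨n₀, fun n₁ n₂ n₃ h₂₁ h₃₂ h₀ => ?_⟩
  have harrow := h n₁ n₂ n₃ ⌊(8 + min δ 1) * n₁⌋₊ h₂₁ h₃₂ h₀.le (Nat.sub_one_lt_floor _).le
  constructor
  · by_contra! hle
    exact not_arrowsCycles_of_le (by omega) hle (Nat.sInf_mem
      (s := {N | ArrowsCycles (⊤ : SimpleGraph (Fin N)) ![2 * n₁ + 1, 2 * n₂ + 1, 2 * n₃ + 1]})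
      ⟨_, harrow⟩)
  · have hle : ramseyCycles ![2 * n₁ + 1, 2 * n₂ + 1, 2 * n₃ + 1] ≤ ⌊(8 + min δ 1) * n₁⌋₊ :=
      Nat.sInf_le harrow
    have hpos : 0 ≤ (8 + min δ 1) * (n₁ : ℝ) :=
      mul_nonneg (add_nonneg (by norm_num) (lt_min hδ one_pos).le) (Nat.cast_nonneg _)
    calc _ ≤ ((⌊(8 + min δ 1) * (n₁ : ℝ)⌋₊ : ℕ) : ℝ) := Nat.cast_le.2 hle
      _ ≤ (8 + min δ 1) * n₁ := Nat.floor_le hpos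
      _ ≤ (8 + δ) * n₁ := by gcongr; exact min_le_left _ _
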